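/- arXiv:1711.09016 — 5 statements merged into one kernel-verified Lean document; each statement's English description precedes it below -/
import Mathlib

section
/- For all integers n ≥ 1 and k ≥ 1, the numbers Ã(n,k) satisfy the recurrence Ã(n+1,k) = (k+1)·Ã(n,k) + (n−k+2)·Ã(n,k−1) − n·Ã(n−1,k−1). -/
open Finset

/-- The number of descents of a permutation of `{1, …, m+1}` (one-line notation:
positions `0, …, m`, a descent at `i` means `π(i) > π(i+1)`). -/
def des {m : ℕ} (π : Equiv.Perm (Fin (m + 1))) : ℕ :=
  (Finset.univ.filter fun i : Fin m => π i.succ < π i.castSucc).card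

/-- The set `𝒬_{m+1}` of permutations of `{1, …, m+1}` that are increasing on the
positions up to the position of the largest entry, i.e. the largest entry appears
as the first descent (the identity permutation is included). -/
def Qset (m : ℕ) : Finset (Equiv.Perm (Fin (m + 1))) :=
  Finset.univ.filter fun π =>
    ∀ i : Fin m, i.succ ≤ π⁻¹ (Fin.last m) → π i.castSucc < π i.succ

/-- `Ã(n,k)`: the number of permutations in `𝒬_{n+1}` with exactly `k` descents. -/
def Atil (n k : ℕ) : ℕ := ((Qset n).filter fun π => des π = k).card


def ins {N : ℕ} (i v : Fin (N+1)) (τ : Equiv.Perm (Fin N)) : Equiv.Perm (Fin (N+1)) :=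
  (finSuccEquiv' i).trans ((Equiv.optionCongr τ).trans (finSuccEquiv' v).symm)

lemma ins_self {N : ℕ} (i v : Fin (N+1)) (τ : Equiv.Perm (Fin N)) : ins i v τ i = v := by
  simp [ins]

lemma ins_succAbove {N : ℕ} (i v : Fin (N+1)) (τ : Equiv.Perm (Fin N)) (j : Fin N) :
    ins i v τ (i.succAbove j) = v.succAbove (τ j) := by
  simp [ins]

lemma ins_bij {N : ℕ} (v : Fin (N+1)) :
    Function.Bijective (fun q : Fin (N+1) × Equiv.Perm (Fin N) => ins q.1 v q.2) := by
  rw [Fintype.bijective_iff_injective_and_card]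
  constructor
  · rintro ⟨i, τ⟩ ⟨i', τ'⟩ h
    simp only at h
    have hi : i = i' := by
      apply (ins i v τ).injective
      rw [ins_self, h, ins_self]
    subst hi
    have : τ = τ' := by
      ext1 j
      have := congrArg (fun f => f (i.succAbove j)) h
      simp only [ins_succAbove] at this
      exact Fin.succAbove_right_injective this
    rw [this]
  · simp [Fintype.card_perm, Nat.factorial_succ]

def pseq {N : ℕ} (τ : Equiv.Perm (Fin N)) (t : ℕ) : ℕ := if h : t < N then (τ ⟨t, h⟩ : ℕ) else 0

def up (v x : ℕ) : ℕ := if x < v then x else x + 1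

lemma up_val {N : ℕ} (v : Fin (N+1)) (j : Fin N) : ((v.succAbove j : Fin (N+1)) : ℕ) = up v j := by
  unfold up Fin.succAbove
  simp only [Fin.lt_def, Fin.val_castSucc]
  split_ifs <;> simp

lemma up_lt {v x y : ℕ} : up v x < up v y ↔ x < y := by
  unfold up; split_ifs <;> omega

lemma sq_ins {N : ℕ} (i v : Fin (N+1)) (τ : Equiv.Perm (Fin N)) (t : ℕ) (ht : t ≤ N) :
    pseq (ins i v τ) t = if t < i then up v (pseq τ t) else if t = i then (v : ℕ)
      else up v (pseq τ (t-1)) := by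
  have hi := i.isLt
  have h0 : pseq (ins i v τ) t = ins i v τ ⟨t, by omega⟩ := by
    simp [pseq, Nat.lt_succ_of_le ht]
  rw [h0]
  split_ifs with h1 h2
  · have : (⟨t, by omega⟩ : Fin (N+1)) = i.succAbove ⟨t, by omega⟩ := by
      ext; rw [up_val]; simp [up, h1]
    rw [this, ins_succAbove, up_val]
    have : t < N := by omega
    simp [pseq, this]
  · have : (⟨t, by omega⟩ : Fin (N+1)) = i := by ext; exact h2
    rw [this, ins_self]
  · have : (⟨t, by omega⟩ : Fin (N+1)) = i.succAbove ⟨t-1, by omega⟩ := by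
      ext; rw [up_val]; simp only [up]; split_ifs <;> omega
    rw [this, ins_succAbove, up_val]
    have : t - 1 < N := by omega
    simp [pseq, this]

lemma des_eq {m : ℕ} (π : Equiv.Perm (Fin (m+1))) :
    des π = ∑ t ∈ range m, if pseq π (t+1) < pseq π t then 1 else 0 := by
  unfold des
  rw [Finset.card_filter, ← Fin.sum_univ_eq_sum_range
    (fun t => if pseq π (t+1) < pseq π t then 1 else 0)]
  apply Finset.sum_congr rfl
  intro i _
  have h1 : (i : ℕ) + 1 < m + 1 := by omega
  have h2 : (i : ℕ) < m + 1 := by omega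
  have e1 : pseq π (i+1) = π i.succ := by simp only [pseq, h1, dif_pos]; rfl
  have e2 : pseq π i = π i.castSucc := by simp only [pseq, h2, dif_pos]; rfl
  rw [e1, e2]; rfl

def pos {m : ℕ} (π : Equiv.Perm (Fin (m+1))) : ℕ := (π⁻¹ (Fin.last m) : Fin (m+1))

lemma pos_le {m : ℕ} (π : Equiv.Perm (Fin (m+1))) : pos π ≤ m := by
  have := (π⁻¹ (Fin.last m)).isLt
  unfold pos; omega

lemma mem_Q {m : ℕ} (π : Equiv.Perm (Fin (m+1))) :
    π ∈ Qset m ↔ ∀ t < pos π, pseq π t < pseq π (t+1) := by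
  have hp := pos_le π
  simp only [Qset, mem_filter, mem_univ, true_and]
  have key : ∀ i : Fin m, (i.succ ≤ π⁻¹ (Fin.last m) ↔ (i:ℕ) < pos π) ∧
      (π i.castSucc < π i.succ ↔ pseq π i < pseq π (i+1)) := by
    intro i
    have h1 : (i : ℕ) + 1 < m + 1 := by omega
    have h2 : (i : ℕ) < m + 1 := by omega
    have e1 : pseq π (i+1) = π i.succ := by simp only [pseq, h1, dif_pos]; rfl
    have e2 : pseq π i = π i.castSucc := by simp only [pseq, h2, dif_pos]; rfl
    rw [e1, e2]
    exact ⟨by rw [Fin.le_def, Fin.val_succ]; exact Nat.succ_le_iff, Iff.rfl⟩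
  constructor
  · intro h t ht
    exact (key ⟨t, by omega⟩).2.1 (h _ ((key ⟨t, by omega⟩).1.2 ht))
  · intro h i hi
    exact (key i).2.2 (h _ ((key i).1.1 hi))

lemma sq_pos {m : ℕ} (π : Equiv.Perm (Fin (m+1))) : pseq π (pos π) = m := by
  have := pos_le π
  have h : pos π < m + 1 := by omega
  simp only [pseq, h, dif_pos]
  have : (⟨pos π, h⟩ : Fin (m+1)) = π⁻¹ (Fin.last m) := by ext; rfl
  rw [this]; simp

lemma pos_ins {m : ℕ} (i v : Fin (m+2)) (hv : v ≠ Fin.last _) (τ : Equiv.Perm (Fin (m+1))) :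
    pos (ins i v τ) = if pos τ < i then pos τ else pos τ + 1 := by
  have : (ins i v τ)⁻¹ (Fin.last (m+1)) = i.succAbove (τ⁻¹ (Fin.last m)) := by
    rw [Equiv.Perm.inv_eq_iff_eq, ins_succAbove]
    simp [hv, Fin.succAbove_ne_last_last]
  unfold pos
  rw [this, up_val]; rfl

/-- pure sequence lemmas -/
lemma D_zero (f g : ℕ → ℕ) (v N : ℕ)
    (hg : ∀ t ≤ N + 1, g t = if t = 0 then v else up v (f (t-1))) :
    ∑ t ∈ range (N+1), (if g (t+1) < g t then 1 else 0) =
      (∑ t ∈ range N, if f (t+1) < f t then 1 else 0) + if up v (f 0) < v then 1 else 0 := by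
  rw [Finset.sum_range_succ', hg 0 (by omega), hg 1 (by omega)]
  simp only [if_true]
  congr 1
  apply Finset.sum_congr rfl
  intro t ht
  rw [mem_range] at ht
  rw [hg (t+1) (by omega), hg (t+1+1) (by omega)]
  simp [up_lt]

lemma D_last (f g : ℕ → ℕ) (v N : ℕ)
    (hg : ∀ t ≤ N + 1, g t = if t < N + 1 then up v (f t) else v) :
    ∑ t ∈ range (N+1), (if g (t+1) < g t then 1 else 0) =
      (∑ t ∈ range N, if f (t+1) < f t then 1 else 0) + if v < up v (f N) then 1 else 0 := by
  rw [Finset.sum_range_succ, hg N (by omega), hg (N+1) (by omega)]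
  simp only [lt_irrefl, if_false, Nat.lt_succ_self, if_true]
  congr 1
  apply Finset.sum_congr rfl
  intro t ht
  rw [mem_range] at ht
  have h1 : t + 1 < N + 1 := by omega
  have h2 : t < N + 1 := by omega
  rw [hg (t+1) (by omega), hg t (by omega), if_pos h1, if_pos h2]
  simp [up_lt]

/-- insertion at place `a+1 ≤ N` -/
lemma D_mid (f g : ℕ → ℕ) (v N a : ℕ) (ha : a + 1 ≤ N)
    (hg : ∀ t ≤ N + 1, g t = if t < a + 1 then up v (f t) else if t = a + 1 then v
      else up v (f (t-1))) :
    ∑ t ∈ range (N+1), (if g (t+1) < g t then 1 else 0) + (if f (a+1) < f a then 1 else 0) =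
      (∑ t ∈ range N, if f (t+1) < f t then 1 else 0) + (if v < up v (f a) then 1 else 0)
       + (if up v (f (a+1)) < v then 1 else 0) := by
  induction N, ha using Nat.le_induction with
  | base =>
    have := D_last f (fun t => if t < a + 1 then up v (f t) else v) v a (by intro t _; rfl)
    rw [Finset.sum_range_succ]
    have e : ∑ t ∈ range (a+1), (if g (t+1) < g t then 1 else 0) =
        ∑ t ∈ range (a+1), (if (if t+1 < a + 1 then up v (f (t+1)) else v)
          < (if t < a + 1 then up v (f t) else v) then 1 else 0) := by
      apply Finset.sum_congr rfl
      intro t ht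
      rw [mem_range] at ht
      rw [hg t (by omega), hg (t+1) (by omega)]
      have : ¬ (t + 1 < a + 1) → t + 1 = a + 1 := by omega
      split_ifs <;> simp_all
    rw [e, this, hg (a+1+1) (by omega), hg (a+1) (by omega), Finset.sum_range_succ]
    simp
    omega
  | succ N hN ih =>
    have := ih (fun t ht => hg t (by omega))
    have s1 := Finset.sum_range_succ (fun t => if g (t+1) < g t then 1 else 0) (N+1)
    have s2 := Finset.sum_range_succ (fun t => if f (t+1) < f t then 1 else 0) N
    have e : (if g (N+1+1) < g (N+1) then 1 else 0) = if f (N+1) < f N then 1 else 0 := by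
      have h1 : ¬ (N + 1 + 1 < a + 1) := by omega
      have h2 : ¬ (N + 1 + 1 = a + 1) := by omega
      have h3 : ¬ (N + 1 < a + 1) := by omega
      have h4 : ¬ (N + 1 = a + 1) := by omega
      rw [hg (N+1+1) (by omega), hg (N+1) (by omega), if_neg h1, if_neg h2, if_neg h3, if_neg h4]
      simp [up_lt]
    omega

lemma up_lt_self {v x : ℕ} : up v x < v ↔ x < v := by
  unfold up; split_ifs <;> omega

lemma lt_up {v x : ℕ} : v < up v x ↔ v ≤ x := by
  unfold up; split_ifs <;> omega

section
variable {m : ℕ} (i v : Fin (m+2)) (τ : Equiv.Perm (Fin (m+1)))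

lemma g_lt (t : ℕ) (ht : t < i) :
    pseq (ins i v τ) t = up v (pseq τ t) := by
  rw [sq_ins _ _ _ _ (by have := i.isLt; omega), if_pos ht]

lemma g_eq : pseq (ins i v τ) i = v := by
  rw [sq_ins _ _ _ _ (by have := i.isLt; omega)]; simp

lemma g_gt (t : ℕ) (ht : i ≤ t) (ht' : t ≤ m) :
    pseq (ins i v τ) (t+1) = up v (pseq τ t) := by
  rw [sq_ins _ _ _ _ (by omega), if_neg (by omega), if_neg (by omega)]; simp

/-- insertion condition in the increasing prefix -/
def Cond (i v : ℕ) (τ : Equiv.Perm (Fin (m+1))) : Prop :=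
  (∀ a, a + 1 = i → pseq τ a < v) ∧ v ≤ pseq τ i

lemma ins_mem_small (hv : v ≠ Fin.last _) (hi : i ≤ pos τ) :
    ins i v τ ∈ Qset (m+1) ↔ τ ∈ Qset m ∧ Cond i v τ := by
  have hp := pos_le τ
  rw [mem_Q, mem_Q, pos_ins _ _ hv, if_neg (by omega)]
  constructor
  · intro h
    have c1 : ∀ a, a + 1 = (i:ℕ) → pseq τ a < v := by
      intro a ha
      have := h a (by omega)
      rw [g_lt _ _ _ _ (by omega), ha, g_eq, up_lt_self] at this
      exact this
    have c2 : (v:ℕ) ≤ pseq τ i := by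
      have := h i (by omega)
      rw [g_eq, g_gt _ _ _ _ le_rfl (by omega), lt_up] at this
      exact this
    refine ⟨?_, c1, c2⟩
    intro t ht
    rcases lt_trichotomy (t+1) (i:ℕ) with h1 | h1 | h1
    · have := h t (by omega)
      rwa [g_lt _ _ _ _ (by omega), g_lt _ _ _ _ (by omega), up_lt] at this
    · have := c1 t h1
      rw [h1]; omega
    · have := h (t+1) (by omega)
      rwa [g_gt _ _ _ _ (by omega) (by omega), g_gt _ _ _ _ (by omega) (by omega), up_lt] at this
  · rintro ⟨h, c1, c2⟩ t ht
    rcases lt_trichotomy t (i:ℕ) with h1 | h1 | h1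
    · rcases eq_or_ne (t+1) (i:ℕ) with h2 | h2
      · rw [g_lt _ _ _ _ (by omega), h2, g_eq, up_lt_self]
        exact c1 t h2
      · rw [g_lt _ _ _ _ (by omega), g_lt _ _ _ _ (by omega), up_lt]
        exact h t (by omega)
    · rw [h1, g_eq, g_gt _ _ _ _ le_rfl (by omega), lt_up]
      exact c2
    · obtain ⟨s, rfl⟩ : ∃ s, t = s + 1 := ⟨t-1, by omega⟩
      rw [g_gt _ _ _ _ (by omega) (by omega), g_gt _ _ _ _ (by omega) (by omega), up_lt]
      exact h s (by omega)

lemma ins_mem_large (hv : v ≠ Fin.last _) (hi : pos τ < i) :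
    ins i v τ ∈ Qset (m+1) ↔ τ ∈ Qset m := by
  rw [mem_Q, mem_Q, pos_ins _ _ hv, if_pos hi]
  refine forall₂_congr fun t ht => ?_
  rw [g_lt _ _ _ _ (by omega)]
  rcases eq_or_ne (t+1) (i:ℕ) with h2 | h2
  · omega
  · rw [g_lt _ _ _ _ (by omega), up_lt]

lemma des_small (hi : i ≤ pos τ) (hQ : τ ∈ Qset m) (hc : Cond i v τ) :
    des (ins i v τ) = des τ := by
  have hp := pos_le τ
  obtain ⟨c1, c2⟩ := hc
  rw [mem_Q] at hQ
  rw [des_eq, des_eq]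
  rcases Nat.eq_zero_or_pos (i:ℕ) with h0 | h0
  · rw [D_zero (pseq τ) _ v m]
    · rw [h0] at c2
      rw [if_neg (by rw [up_lt_self]; omega)]; rfl
    · intro t ht
      rw [sq_ins _ _ _ _ ht, h0]; simp
  · obtain ⟨a, ha⟩ : ∃ a, (i:ℕ) = a + 1 := ⟨i-1, by omega⟩
    have := D_mid (pseq τ) (pseq (ins i v τ)) v m a (by omega)
      (by intro t ht; rw [sq_ins _ _ _ _ ht, ha])
    have q := hQ a (by omega)
    have c3 := c1 a ha.symm
    rw [ha] at c2
    rw [if_neg (by omega), if_neg (by rw [lt_up]; omega), if_neg (by rw [up_lt_self]; omega)] at this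
    simpa using this

lemma des_large (hi : pos τ < i) (hv : v = 0) :
    des (ins i v τ) = des τ + if (i:ℕ) ≤ m ∧ pseq τ i < pseq τ (i-1) then 0 else 1 := by
  have hlt := i.isLt
  rw [des_eq, des_eq]
  obtain ⟨a, ha⟩ : ∃ a, (i:ℕ) = a + 1 := ⟨i-1, by omega⟩
  have hv0 : (v:ℕ) = 0 := by simp [hv]
  by_cases h : (i:ℕ) ≤ m
  · have := D_mid (pseq τ) (pseq (ins i v τ)) v m a (by omega)
      (by intro t ht; rw [sq_ins _ _ _ _ ht, ha])
    rw [if_pos (c := (v:ℕ) < _) (by rw [lt_up]; omega),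
      if_neg (c := _ < (v:ℕ)) (by rw [up_lt_self]; omega)] at this
    simp only [h, true_and, ha, Nat.add_sub_cancel]
    split_ifs at this ⊢ <;> omega
  · have ham : a = m := by omega
    subst ham
    have := D_last (pseq τ) (pseq (ins i v τ)) v a
      (by
        intro t ht; rw [sq_ins _ _ _ _ ht, ha]
        by_cases h : t < a + 1
        · simp [h]
        · simp [show t = a + 1 by omega])
    rw [this, if_pos (by rw [lt_up]; omega), if_neg (by omega)]

end

lemma pseq_lt_of_Q {m : ℕ} {τ : Equiv.Perm (Fin (m+1))} (hQ : τ ∈ Qset m) {s t : ℕ}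
    (h : s ≤ t) (ht : t ≤ pos τ) : pseq τ s ≤ pseq τ t := by
  rw [mem_Q] at hQ
  induction t, h using Nat.le_induction with
  | base => exact le_rfl
  | succ t hst ih =>
    have := hQ t (by omega)
    have := ih (by omega)
    omega

lemma exists_unique_cond {m : ℕ} {τ : Equiv.Perm (Fin (m+1))} (hQ : τ ∈ Qset m)
    (v : ℕ) (hv : v ≤ m) : ∃ i, (i ≤ pos τ ∧ Cond i v τ) ∧ ∀ j, (j ≤ pos τ ∧ Cond j v τ) → j = i := by
  have hex : ∃ i, v ≤ pseq τ i := ⟨pos τ, by rw [sq_pos]; exact hv⟩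
  classical
  refine ⟨Nat.find hex, ⟨Nat.find_min' hex (by rw [sq_pos]; exact hv), ?_, Nat.find_spec hex⟩, ?_⟩
  · intro a ha
    have := Nat.find_min hex (m := a) (by omega)
    omega
  · rintro j ⟨hj, c1, c2⟩
    have h1 := Nat.find_min' hex c2
    by_contra hne
    have h2 := c1 (j-1) (by omega)
    have h3 := pseq_lt_of_Q hQ (s := Nat.find hex) (t := j-1) (by omega) (by omega)
    have h4 := Nat.find_spec hex
    omega

/-- transfer of counting along the insertion bijection -/
lemma card_ins {N : ℕ} (v : Fin (N+1)) (P : Equiv.Perm (Fin (N+1)) → Prop) [DecidablePred P] :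
    (univ.filter P).card =
      ∑ τ : Equiv.Perm (Fin N), (univ.filter fun i : Fin (N+1) => P (ins i v τ)).card := by
  simp only [Finset.card_filter]
  rw [← Fintype.sum_prod_type_right (f := fun q : Fin (N+1) × Equiv.Perm (Fin N) =>
    if P (ins q.1 v q.2) then 1 else 0)]
  exact (Function.Bijective.sum_comp (ins_bij v) (fun π => if P π then 1 else 0)).symm

lemma Atil_eq (n k : ℕ) : Atil n k = (univ.filter fun π : Equiv.Perm (Fin (n+1)) =>
    π ∈ Qset n ∧ des π = k).card := by
  unfold Atil
  congr 1
  ext π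
  simp

lemma step2_v (m k : ℕ) (v : Fin (m+2)) (hv : v ≠ Fin.last _) :
    (univ.filter fun π : Equiv.Perm (Fin (m+2)) =>
      (π ∈ Qset (m+1) ∧ des π = k) ∧ (π⁻¹ v : Fin (m+2)) < (pos π)).card = Atil m k := by
  rw [card_ins v, Atil_eq, Finset.card_filter]
  apply Finset.sum_congr rfl
  intro τ _
  have hpl := pos_le τ
  have hv' : (v:ℕ) ≤ m := by
    have := Fin.val_lt_last hv; omega
  have key : ∀ i : Fin (m+2), (((ins i v τ ∈ Qset (m+1) ∧ des (ins i v τ) = k) ∧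
      ((ins i v τ)⁻¹ v : Fin (m+2)) < (pos (ins i v τ))) ↔
      ((τ ∈ Qset m ∧ des τ = k) ∧ ((i:ℕ) ≤ pos τ ∧ Cond i v τ))) := by
    intro i
    have e : (ins i v τ)⁻¹ v = i := by
      rw [Equiv.Perm.inv_eq_iff_eq, ins_self]
    rw [e, pos_ins _ _ hv]
    by_cases hi : (i:ℕ) ≤ pos τ
    · rw [ins_mem_small _ _ _ hv hi, if_neg (by omega)]
      constructor
      · rintro ⟨⟨⟨h1, h2⟩, h3⟩, h4⟩
        rw [des_small _ _ _ hi h1 h2] at h3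
        exact ⟨⟨h1, h3⟩, hi, h2⟩
      · rintro ⟨⟨h1, h3⟩, h4, h2⟩
        refine ⟨⟨⟨h1, h2⟩, ?_⟩, by omega⟩
        rw [des_small _ _ _ hi h1 h2, h3]
    · rw [if_pos (by omega)]
      constructor
      · rintro ⟨_, h⟩; omega
      · rintro ⟨_, h, _⟩; omega
  classical
  rw [Finset.filter_congr (fun i _ => key i)]
  split_ifs with h
  · obtain ⟨i, ⟨h1, h2⟩, h3⟩ := exists_unique_cond h.1 v hv'
    rw [Finset.card_eq_one]
    refine ⟨⟨i, by omega⟩, ?_⟩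
    ext j
    simp only [mem_filter, mem_univ, true_and, mem_singleton, h]
    constructor
    · intro hj
      ext
      exact h3 _ hj
    · rintro rfl
      exact ⟨h1, h2⟩
  · simp [h]

lemma step2 (m k : ℕ) :
    ∑ π ∈ (Qset (m+1)).filter (fun π => des π = k), pos π = (m+1) * Atil m k := by
  have h1 : ∀ π : Equiv.Perm (Fin (m+2)), pos π =
      ∑ v : Fin (m+1), if (π⁻¹ v.castSucc : Fin (m+2)) < (pos π) then 1 else 0 := by
    intro π
    have hp := pos_le π
    have e1 : ∑ v : Fin (m+2), (if ((π⁻¹ v : Fin (m+2)) : ℕ) < pos π then 1 else 0) = pos π := by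
      rw [Equiv.sum_comp π⁻¹ (fun j : Fin (m+2) => if (j:ℕ) < pos π then 1 else 0),
        Fin.sum_univ_eq_sum_range (fun j => if j < pos π then 1 else 0), ← Finset.card_filter]
      have : (range (m+2)).filter (fun j => j < pos π) = range (pos π) := by
        ext j; simp; omega
      rw [this, card_range]
    rw [Fin.sum_univ_castSucc] at e1
    have e2 : ((π⁻¹ (Fin.last (m+1)) : Fin (m+2)) : ℕ) = pos π := rfl
    rw [e2] at e1
    simp only [lt_irrefl, if_false, add_zero] at e1
    exact e1.symm
  rw [Finset.sum_congr rfl (fun π _ => h1 π), Finset.sum_comm]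
  have h2 : ∀ v : Fin (m+1), ∑ π ∈ (Qset (m+1)).filter (fun π => des π = k),
      (if ((π⁻¹ v.castSucc : Fin (m+2)) : ℕ) < (pos π) then 1 else 0) = Atil m k := by
    intro v
    rw [← step2_v m k v.castSucc (Fin.castSucc_lt_last v).ne, ← Finset.card_filter]
    congr 1
    ext π
    simp
  rw [Finset.sum_congr rfl (fun v _ => h2 v)]
  simp

/-- number of insertion places after the maximum keeping the number of descents -/
lemma count_desc {m : ℕ} (τ : Equiv.Perm (Fin (m+1))) (hQ : τ ∈ Qset m) :
    (univ.filter fun i : Fin (m+2) => pos τ < i ∧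
      ((i:ℕ) ≤ m ∧ pseq τ i < pseq τ (i-1))).card = des τ := by
  rw [mem_Q] at hQ
  rw [des_eq, Finset.card_filter, Fin.sum_univ_eq_sum_range
    (fun i => if pos τ < i ∧ (i ≤ m ∧ pseq τ i < pseq τ (i-1)) then 1 else 0) (m+2),
    Finset.sum_range_succ', Finset.sum_range_succ]
  simp only [Nat.add_sub_cancel]
  rw [if_neg (by omega), if_neg (by omega), add_zero, add_zero]
  apply Finset.sum_congr rfl
  intro t ht
  rw [mem_range] at ht
  have : (pos τ < t + 1 ∧ t + 1 ≤ m ∧ pseq τ (t+1) < pseq τ t) ↔ pseq τ (t+1) < pseq τ t := by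
    constructor
    · exact fun h => h.2.2
    · intro h
      refine ⟨?_, by omega, h⟩
      by_contra hc
      have := hQ t (by omega)
      omega
  simp only [this]

lemma count_large {m : ℕ} (τ : Equiv.Perm (Fin (m+1))) :
    (univ.filter fun i : Fin (m+2) => pos τ < i).card + pos τ = m + 1 := by
  have hp := pos_le τ
  rw [Finset.card_filter, Fin.sum_univ_eq_sum_range (fun i => if pos τ < i then 1 else 0) (m+2),
    ← Finset.card_filter]
  have : (range (m+2)).filter (fun j => pos τ < j) = Ico (pos τ + 1) (m+2) := by
    ext j; simp; omega
  rw [this, Nat.card_Ico]; omega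

lemma step1_tau (m k : ℕ) (hk : 1 ≤ k) (τ : Equiv.Perm (Fin (m+1))) :
    ((univ.filter fun i : Fin (m+2) =>
      ins i 0 τ ∈ Qset (m+1) ∧ des (ins i 0 τ) = k).card : ℤ) =
      (if τ ∈ Qset m ∧ des τ = k then (k:ℤ) + 1 else 0) +
      (if τ ∈ Qset m ∧ des τ = k - 1 then (m:ℤ) - k + 2 - pos τ else 0) := by
  have hv : (0 : Fin (m+2)) ≠ Fin.last _ := (Fin.last_pos).ne
  have hpl := pos_le τ
  by_cases hQ : τ ∈ Qset m
  swap
  · simp only [hQ, false_and, if_false, add_zero, Nat.cast_eq_zero, Finset.card_eq_zero]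
    ext i
    simp only [mem_filter, mem_univ, true_and, notMem_empty, iff_false]
    rintro ⟨h, _⟩
    by_cases hi : (i:ℕ) ≤ pos τ
    · exact hQ ((ins_mem_small _ _ _ hv hi).1 h).1
    · exact hQ ((ins_mem_large _ _ _ hv (by omega)).1 h)
  have key : ∀ i : Fin (m+2), ((ins i 0 τ ∈ Qset (m+1) ∧ des (ins i 0 τ) = k) ↔
      ((i = 0 ∧ des τ = k) ∨ (pos τ < i ∧
        des τ + (if (i:ℕ) ≤ m ∧ pseq τ i < pseq τ (i-1) then 0 else 1) = k))) := by
    intro i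
    by_cases hi : (i:ℕ) ≤ pos τ
    · rw [ins_mem_small _ _ _ hv hi]
      have hc : Cond i (0 : Fin (m+2)) τ ↔ i = 0 := by
        unfold Cond
        constructor
        · rintro ⟨c1, _⟩
          by_contra hne
          have : (i:ℕ) ≠ 0 := fun h => hne (Fin.ext h)
          have := c1 (i-1) (by omega)
          simp at this
        · rintro rfl
          simp
      constructor
      · rintro ⟨⟨_, h1⟩, h2⟩
        rw [des_small _ _ _ hi hQ h1] at h2
        exact Or.inl ⟨hc.1 h1, h2⟩
      · rintro (⟨h1, h2⟩ | ⟨h1, h2⟩)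
        · refine ⟨⟨hQ, hc.2 h1⟩, ?_⟩
          rw [des_small _ _ _ hi hQ (hc.2 h1), h2]
        · omega
    · have hi' : pos τ < i := by omega
      rw [ins_mem_large _ _ _ hv hi', des_large _ _ _ hi' rfl]
      constructor
      · rintro ⟨_, h⟩
        exact Or.inr ⟨hi', h⟩
      · rintro (⟨rfl, _⟩ | ⟨_, h⟩)
        · simp at hi'
        · exact ⟨hQ, h⟩
  simp only [key, hQ, true_and]
  have cd := count_desc τ hQ
  have cl := count_large τ
  by_cases h1 : des τ = k
  · rw [if_pos h1, if_neg (by omega), add_zero]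
    have : (univ.filter fun i : Fin (m+2) => (i = 0 ∧ des τ = k) ∨ (pos τ < i ∧
        des τ + (if (i:ℕ) ≤ m ∧ pseq τ i < pseq τ (i-1) then 0 else 1) = k)) =
        insert 0 (univ.filter fun i : Fin (m+2) => pos τ < i ∧
      ((i:ℕ) ≤ m ∧ pseq τ i < pseq τ (i-1))) := by
      ext i
      simp only [mem_filter, mem_univ, true_and, mem_insert, h1, and_true]
      refine or_congr Iff.rfl (and_congr Iff.rfl ?_)
      split_ifs with h <;> simp [h]
    rw [this, Finset.card_insert_of_notMem (by simp), cd, h1]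
    push_cast; ring
  · rw [if_neg h1, zero_add]
    have split := Finset.card_filter_add_card_filter_not (s := univ.filter fun i : Fin (m+2) => pos τ < i)
      (fun i : Fin (m+2) => (i:ℕ) ≤ m ∧ pseq τ i < pseq τ (i-1))
    rw [Finset.filter_filter, Finset.filter_filter, cd] at split
    split_ifs with h2
    · have : (univ.filter fun i : Fin (m+2) => (i = 0 ∧ des τ = k) ∨ (pos τ < i ∧
        des τ + (if (i:ℕ) ≤ m ∧ pseq τ i < pseq τ (i-1) then 0 else 1) = k)) =
        (univ.filter fun i : Fin (m+2) => pos τ < i ∧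
          ¬ ((i:ℕ) ≤ m ∧ pseq τ i < pseq τ (i-1))) := by
        ext i
        simp only [mem_filter, mem_univ, true_and, h1, and_false, false_or]
        refine and_congr Iff.rfl ?_
        split_ifs with h
        · simp only [h, and_self, not_true, iff_false]; omega
        · simp only [h, not_false_iff, iff_true]; omega
      rw [this]
      omega
    · simp only [Nat.cast_eq_zero, Finset.card_eq_zero]
      ext i
      simp only [mem_filter, mem_univ, true_and, notMem_empty, iff_false, h1, and_false, false_or]
      rintro ⟨_, h⟩
      split_ifs at h <;> omega

theorem Atil_recurrence (n k : ℕ) (hn : 1 ≤ n) (hk : 1 ≤ k) :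
    (Atil (n + 1) k : ℤ) =
      (k + 1) * Atil n k + ((n : ℤ) - k + 2) * Atil n (k - 1)
        - n * Atil (n - 1) (k - 1) := by
  obtain ⟨m, rfl⟩ : ∃ m, n = m + 1 := ⟨n - 1, by omega⟩
  have h2 := step2 m (k-1)
  rw [Atil_eq (m+1+1) k, card_ins 0]
  push_cast
  rw [Finset.sum_congr rfl (fun τ _ => step1_tau (m+1) k hk τ), Finset.sum_add_distrib,
    ← Finset.sum_filter, ← Finset.sum_filter, Finset.sum_sub_distrib]
  have e : ∀ j, (univ.filter fun π : Equiv.Perm (Fin (m+1+1)) => π ∈ Qset (m+1) ∧ des π = j) =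
      (Qset (m+1)).filter (fun π => des π = j) := by
    intro j; ext π; simp
  rw [e, e, Finset.sum_const, Finset.sum_const, ← Nat.cast_sum, h2]
  simp only [nsmul_eq_mul, Nat.add_sub_cancel]
  unfold Atil
  push_cast
  ring
end

section
/- For all integers n ≥ 0 and k ≥ 0, the number of permutations in 𝒬_{n+1} with exactly k descents equals the number of permutations in 𝒬_{n+1} with exactly k ascents. -/
open Finset

/-- The number of ascents of a permutation of `{1, …, m+1}`. -/
def asc {m : ℕ} (π : Equiv.Perm (Fin (m + 1))) : ℕ :=
  (Finset.univ.filter fun i : Fin m => π i.castSucc < π i.succ).card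

/-- Number of adjacent pairs of a word related by `r`. -/
def cnt (r : ℕ → ℕ → Prop) [DecidableRel r] : List ℕ → ℕ
  | [] => 0
  | [_] => 0
  | a :: b :: l => (if r a b then 1 else 0) + cnt r (b :: l)

theorem cnt_split (r : ℕ → ℕ → Prop) [DecidableRel r] (l1 : List ℕ) (a : ℕ) (l2 : List ℕ) :
    cnt r (l1 ++ a :: l2) = cnt r (l1 ++ [a]) + cnt r (a :: l2) := by
  induction l1 with
  | nil => simp [cnt]
  | cons x t ih =>
    cases t with
    | nil => simp [cnt]
    | cons y t => simp only [List.cons_append, cnt] at ih ⊢; omega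

theorem cnt_reverse (r s : ℕ → ℕ → Prop) [DecidableRel r] [DecidableRel s]
    (h : ∀ a b, r a b ↔ s b a) (l : List ℕ) : cnt r l.reverse = cnt s l := by
  induction l with
  | nil => simp [cnt]
  | cons x t ih =>
    cases t with
    | nil => simp [cnt]
    | cons y t =>
      have := cnt_split r t.reverse y [x]
      simp only [List.reverse_cons, List.append_assoc, List.cons_append, List.nil_append, cnt] at ih ⊢ this
      rw [this, ih]
      simp [h]; omega

theorem cnt_cons (r : ℕ → ℕ → Prop) [DecidableRel r] (a : ℕ) (l : List ℕ) (hl : l ≠ [])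
    (p : Prop) [Decidable p] (h : ∀ x ∈ l, (r a x ↔ p)) :
    cnt r (a :: l) = (if p then 1 else 0) + cnt r l := by
  cases l with
  | nil => simp at hl
  | cons y t => simp [cnt, h y]

theorem cnt_concat (r : ℕ → ℕ → Prop) [DecidableRel r] (a : ℕ) (l : List ℕ) (hl : l ≠ [])
    (p : Prop) [Decidable p] (h : ∀ x ∈ l, (r x a ↔ p)) :
    cnt r (l ++ [a]) = (if p then 1 else 0) + cnt r l := by
  rw [← cnt_reverse (fun a b => r b a) r (fun _ _ => Iff.rfl),
    ← cnt_reverse (fun a b => r b a) r (fun _ _ => Iff.rfl) l]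
  rw [List.reverse_append]
  exact cnt_cons _ a l.reverse (by simpa using hl) p (by simpa using h)

/-- The graph of an involution exchanging ascents and descents on words whose
maximal letter ends the initial increasing run. -/
inductive WRel : List ℕ → List ℕ → Prop
  | single (M : ℕ) : WRel [M] [M]
  | front (a : ℕ) (l l' : List ℕ) : WRel l l' → (∀ x ∈ l, a < x) → WRel (a :: l) (l' ++ [a])
  | back (a : ℕ) (l l' : List ℕ) : WRel l l' → (∀ x ∈ l, a < x) → WRel (l ++ [a]) (a :: l')
  | mid (a : ℕ) (l1 l1' l2 : List ℕ) : WRel l1 l1' → (∀ x ∈ l1, a < x) → (∀ x ∈ l2, a < x) →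
      l2 ≠ [] → (∃ m ∈ l1, ∀ x ∈ l2, x < m) → WRel (l1 ++ a :: l2) (l1' ++ a :: l2.reverse)

theorem WRel.perm {l l' : List ℕ} (h : WRel l l') : l.Perm l' := by
  induction h with
  | single M => exact List.Perm.refl _
  | front a l l' _ _ ih => exact (ih.cons a).trans (List.perm_append_singleton a l').symm
  | back a l l' _ _ ih => exact (List.perm_append_singleton a l).trans (ih.cons a)
  | mid a l1 l1' l2 _ _ _ _ _ ih => exact ih.append ((List.reverse_perm l2).symm.cons a)

theorem WRel.symm {l l' : List ℕ} (h : WRel l l') : WRel l' l := by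
  induction h with
  | single M => exact .single M
  | front a l l' h h1 ih => exact .back a _ _ ih (fun x hx => h1 x (h.perm.mem_iff.2 hx))
  | back a l l' h h1 ih => exact .front a _ _ ih (fun x hx => h1 x (h.perm.mem_iff.2 hx))
  | mid a l1 l1' l2 h h1 h2 h3 h4 ih =>
    have := WRel.mid a l1' l1 l2.reverse ih (fun x hx => h1 x (h.perm.mem_iff.2 hx))
      (by simpa using h2) (by simpa using h3) (by
        obtain ⟨m, hm, hx⟩ := h4
        exact ⟨m, h.perm.mem_iff.1 hm, by simpa using hx⟩)
    simpa using this

theorem WRel.ne_nil {l l' : List ℕ} (h : WRel l l') : l ≠ [] := by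
  cases h <;> simp

theorem WRel.ne_nil' {l l' : List ℕ} (h : WRel l l') : l' ≠ [] := h.symm.ne_nil

theorem WRel.cnt_eq {l l' : List ℕ} (h : WRel l l') :
    cnt (fun a b => b < a) l' = cnt (fun a b => a < b) l ∧
    cnt (fun a b => a < b) l' = cnt (fun a b => b < a) l := by
  induction h with
  | single M => simp [cnt]
  | front a l l' h h1 ih =>
    have h1' : ∀ x ∈ l', a < x := fun x hx => h1 x (h.perm.mem_iff.2 hx)
    rw [cnt_concat (fun a b => b < a) a l' h.ne_nil' True (by simpa using h1'),
      cnt_concat (fun a b => a < b) a l' h.ne_nil' False (by simpa using fun x hx => (h1' x hx).le),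
      cnt_cons (fun a b => a < b) a l h.ne_nil True (by simpa using h1),
      cnt_cons (fun a b => b < a) a l h.ne_nil False (by simpa using fun x hx => (h1 x hx).le)]
    simp [ih]
  | back a l l' h h1 ih =>
    have h1' : ∀ x ∈ l', a < x := fun x hx => h1 x (h.perm.mem_iff.2 hx)
    rw [cnt_concat (fun a b => b < a) a l h.ne_nil True (by simpa using h1),
      cnt_concat (fun a b => a < b) a l h.ne_nil False (by simpa using fun x hx => (h1 x hx).le),
      cnt_cons (fun a b => a < b) a l' h.ne_nil' True (by simpa using h1'),
      cnt_cons (fun a b => b < a) a l' h.ne_nil' False (by simpa using fun x hx => (h1' x hx).le)]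
    simp [ih]
  | mid a l l' l2 h h1 h2 h3 h4 ih =>
    have h1' : ∀ x ∈ l', a < x := fun x hx => h1 x (h.perm.mem_iff.2 hx)
    rw [cnt_split (fun a b => a < b) l a l2, cnt_split (fun a b => b < a) l a l2,
      cnt_split (fun a b => a < b) l' a l2.reverse, cnt_split (fun a b => b < a) l' a l2.reverse,
      cnt_concat (fun a b => b < a) a l h.ne_nil True (by simpa using h1),
      cnt_concat (fun a b => a < b) a l h.ne_nil False (by simpa using fun x hx => (h1 x hx).le),
      cnt_concat (fun a b => b < a) a l' h.ne_nil' True (by simpa using h1'),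
      cnt_concat (fun a b => a < b) a l' h.ne_nil' False (by simpa using fun x hx => (h1' x hx).le),
      cnt_cons (fun a b => a < b) a l2 h3 True (by simpa using h2),
      cnt_cons (fun a b => b < a) a l2 h3 False (by simpa using fun x hx => (h2 x hx).le),
      cnt_cons (fun a b => a < b) a l2.reverse (by simpa using h3) True (by simpa using h2),
      cnt_cons (fun a b => b < a) a l2.reverse (by simpa using h3) False
        (by simpa using fun x hx => (h2 x hx).le),
      cnt_reverse (fun a b => a < b) (fun a b => b < a) (fun _ _ => Iff.rfl),
      cnt_reverse (fun a b => b < a) (fun a b => a < b) (fun _ _ => Iff.rfl), ih.1, ih.2]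
    simp; omega

theorem split_unique (l1 : List ℕ) : ∀ (l1' l2 l2' : List ℕ) (a a' : ℕ),
    l1 ++ a :: l2 = l1' ++ a' :: l2' →
    (∀ x ∈ l1, a < x) → (∀ x ∈ l2, a < x) → (∀ x ∈ l1', a' < x) → (∀ x ∈ l2', a' < x) →
    l1 = l1' ∧ a = a' ∧ l2 = l2' := by
  induction l1 with
  | nil =>
    intro l1' l2 l2' a a' h h1 h2 h3 h4
    cases l1' with
    | nil => simpa using h
    | cons y t =>
      simp only [List.nil_append, List.cons_append, List.cons.injEq] at h
      obtain ⟨rfl, rfl⟩ := h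
      have := h2 a' (by simp)
      have := h3 a (by simp)
      omega
  | cons x s ih =>
    intro l1' l2 l2' a a' h h1 h2 h3 h4
    cases l1' with
    | nil =>
      simp only [List.nil_append, List.cons_append, List.cons.injEq] at h
      obtain ⟨rfl, rfl⟩ := h
      have := h4 a (by simp)
      have := h1 x (by simp)
      omega
    | cons y t =>
      simp only [List.cons_append, List.cons.injEq] at h
      obtain ⟨rfl, h⟩ := h
      obtain ⟨rfl, rfl, rfl⟩ := ih t l2 l2' a a' h (fun z hz => h1 z (by simp [hz])) h2
        (fun z hz => h3 z (by simp [hz])) h4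
      simp

theorem WRel.inv {l r : List ℕ} (h : WRel l r) :
    ∃ l1 a l2, l = l1 ++ a :: l2 ∧ (∀ x ∈ l1, a < x) ∧ (∀ x ∈ l2, a < x) ∧
      ((l1 = [] ∧ l2 = [] ∧ r = [a]) ∨
       (l1 = [] ∧ l2 ≠ [] ∧ ∃ l', WRel l2 l' ∧ r = l' ++ [a]) ∨
       (l1 ≠ [] ∧ l2 = [] ∧ ∃ l', WRel l1 l' ∧ r = a :: l') ∨
       (l1 ≠ [] ∧ l2 ≠ [] ∧ ∃ l', WRel l1 l' ∧ r = l' ++ a :: l2.reverse)) := by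
  cases h with
  | single M => exact ⟨[], M, [], by simp⟩
  | front a l l' h h1 => exact ⟨[], a, l, rfl, by simp, h1, .inr (.inl ⟨rfl, h.ne_nil, l', h, rfl⟩)⟩
  | back a l l' h h1 =>
    exact ⟨l, a, [], rfl, h1, by simp, .inr (.inr (.inl ⟨h.ne_nil, rfl, l', h, rfl⟩))⟩
  | mid a l1 l1' l2 h h1 h2 h3 h4 =>
    exact ⟨l1, a, l2, rfl, h1, h2, .inr (.inr (.inr ⟨h.ne_nil, h3, l1', h, rfl⟩))⟩

theorem WRel.unique {l r : List ℕ} (h : WRel l r) : ∀ {r' : List ℕ}, WRel l r' → r = r' := by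
  induction h with
  | single M =>
    intro r' h'
    obtain ⟨l1, a, l2, e, h1, h2, h3⟩ := h'.inv
    obtain ⟨rfl, rfl, rfl⟩ := split_unique [] l1 [] l2 M a e (by simp) (by simp) h1 h2
    simp at h3; simp [h3]
  | front b l l' h h1 ih =>
    intro r' h'
    obtain ⟨l1, a, l2, e, h1', h2', h3⟩ := h'.inv
    obtain ⟨rfl, rfl, rfl⟩ := split_unique [] l1 l l2 b a e (by simp) h1 h1' h2'
    simp [h.ne_nil] at h3
    obtain ⟨l'', hl, rfl⟩ := h3
    rw [ih hl]
  | back b l l' h h1 ih =>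
    intro r' h'
    obtain ⟨l1, a, l2, e, h1', h2', h3⟩ := h'.inv
    obtain ⟨rfl, rfl, rfl⟩ := split_unique l l1 [] l2 b a e h1 (by simp) h1' h2'
    simp [h.ne_nil] at h3
    obtain ⟨l'', hl, rfl⟩ := h3
    rw [ih hl]
  | mid b l l' t h h1 h2 hn _ ih =>
    intro r' h'
    obtain ⟨l1, a, l2, e, h1', h2', h3⟩ := h'.inv
    obtain ⟨rfl, rfl, rfl⟩ := split_unique l l1 t l2 b a e h1 h2 h1' h2'
    simp [h.ne_nil, hn] at h3
    obtain ⟨l'', hl, rfl⟩ := h3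
    rw [ih hl]

/-- Words whose maximal letter ends an initial increasing run. -/
def QL (l : List ℕ) : Prop :=
  ∃ p M w, l = p ++ M :: w ∧ (p ++ [M]).Pairwise (· < ·) ∧ ∀ x ∈ w, x < M

theorem WRel.ql {l r : List ℕ} (h : WRel l r) : QL l := by
  induction h with
  | single M => exact ⟨[], M, [], by simp⟩
  | front a l l' h h1 ih =>
    obtain ⟨p, M, w, rfl, hp, hw⟩ := ih
    refine ⟨a :: p, M, w, rfl, ?_, hw⟩
    rw [List.cons_append, List.pairwise_cons]
    exact ⟨fun x hx => h1 x (by simp at hx ⊢; tauto), hp⟩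
  | back a l l' h h1 ih =>
    obtain ⟨p, M, w, rfl, hp, hw⟩ := ih
    refine ⟨p, M, w ++ [a], by simp, hp, ?_⟩
    intro x hx
    rcases List.mem_append.1 hx with hx | hx
    · exact hw x hx
    · rw [List.mem_singleton.1 hx]; exact h1 M (by simp)
  | mid a l l' t h h1 h2 hn h4 ih =>
    obtain ⟨p, M, w, rfl, hp, hw⟩ := ih
    refine ⟨p, M, w ++ a :: t, by simp, hp, ?_⟩
    obtain ⟨m, hm, hmt⟩ := h4
    have hmM : m ≤ M := by
      rw [List.pairwise_append] at hp
      simp at hm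
      rcases hm with hm | hm | hm
      · exact (hp.2.2 m hm M (by simp)).le
      · exact hm.le
      · exact (hw m hm).le
    intro x hx
    simp at hx
    rcases hx with hx | hx | hx
    · exact hw x hx
    · rw [hx]; exact h1 M (by simp)
    · exact (hmt x hx).trans_le hmM

theorem exists_min_split (l : List ℕ) (hl : l ≠ []) : ∃ a ∈ l, ∀ x ∈ l, a ≤ x := by
  obtain ⟨a, ha, h⟩ := l.toFinset.exists_min_image id (by simpa using hl)
  exact ⟨a, by simpa using ha, by simpa using h⟩

theorem QL.total : ∀ (n : ℕ) (l : List ℕ), l.length = n → l.Nodup → QL l → ∃ r, WRel l r := by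
  intro n
  induction n using Nat.strong_induction_on with
  | _ n ih =>
    rintro l hl hnd ⟨p, M, w, rfl, hp, hw⟩
    obtain ⟨a, ha, hmin⟩ := exists_min_split (p ++ M :: w) (by simp)
    have hpM : ∀ x ∈ p, x < M := fun x hx => (List.pairwise_append.1 hp).2.2 x hx M (by simp)
    have key : a ∈ p ∨ a = M ∨ a ∈ w := by simpa using ha
    rcases key with h | h | h
    · obtain ⟨s, t, rfl⟩ := List.append_of_mem h
      cases s with
      | cons y s =>
        have h1 := hmin y (by simp)
        simp only [List.cons_append, List.pairwise_cons] at hp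
        have h2 := hp.1 a (by simp)
        omega
      | nil =>
        simp only [List.nil_append, List.cons_append] at *
        have hnd' := List.nodup_cons.1 hnd
        obtain ⟨r, hr⟩ := ih (t ++ M :: w).length (by simp at hl ⊢; omega) _ rfl hnd'.2
          ⟨t, M, w, rfl, (List.pairwise_cons.1 hp).2, hw⟩
        refine ⟨_, WRel.front a _ _ hr ?_⟩
        intro x hx
        refine lt_of_le_of_ne (hmin x (List.mem_cons_of_mem _ hx)) ?_
        rintro rfl
        exact hnd'.1 hx
    · subst h
      have hp0 : p = [] := by
        rw [List.eq_nil_iff_forall_not_mem]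
        intro x hx
        have := hpM x hx
        have := hmin x (by simp [hx])
        omega
      have hw0 : w = [] := by
        rw [List.eq_nil_iff_forall_not_mem]
        intro x hx
        have := hw x hx
        have := hmin x (by simp [hx])
        omega
      subst hp0 hw0
      exact ⟨_, WRel.single a⟩
    · obtain ⟨s, t, rfl⟩ := List.append_of_mem h
      have e : p ++ M :: (s ++ a :: t) = (p ++ M :: s) ++ a :: t := by simp
      rw [e] at hnd hmin hl ⊢
      have hnd' := List.nodup_middle.1 hnd
      have hna := (List.nodup_cons.1 hnd').1
      have hlt : ∀ x ∈ (p ++ M :: s) ++ t, a < x := by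
        intro x hx
        refine lt_of_le_of_ne (hmin x (by simp at hx ⊢; tauto)) ?_
        rintro rfl
        exact hna hx
      obtain ⟨r, hr⟩ := ih (p ++ M :: s).length (by simp at hl ⊢; omega) _ rfl
          (List.nodup_append.1 hnd).1
          ⟨p, M, s, rfl, hp, fun x hx => hw x (by simp [hx])⟩
      by_cases ht : t = []
      · subst ht
        exact ⟨_, WRel.back a _ _ hr (fun x hx => hlt x (List.mem_append_left _ hx))⟩
      · exact ⟨_, WRel.mid a _ _ t hr (fun x hx => hlt x (List.mem_append_left _ hx))
          (fun x hx => hlt x (List.mem_append_right _ hx)) ht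
          ⟨M, by simp, fun x hx => hw x (by simp [hx])⟩⟩

/-- The one-line notation of a permutation. -/
def word {m : ℕ} (π : Equiv.Perm (Fin (m + 1))) : List ℕ := List.ofFn fun i => (π i).val

theorem cnt_ofFn (r : ℕ → ℕ → Prop) [DecidableRel r] (m : ℕ) (f : Fin (m + 1) → ℕ) :
    cnt r (List.ofFn f) =
      (Finset.univ.filter fun i : Fin m => r (f i.castSucc) (f i.succ)).card := by
  induction m with
  | zero => simp [cnt]
  | succ m ih =>
    have := ih (fun i => f i.succ)
    rw [Finset.card_filter] at this ⊢
    rw [Fin.sum_univ_succ, List.ofFn_succ, List.ofFn_succ, cnt]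
    rw [List.ofFn_succ] at this
    rw [this]
    rfl

theorem word_nodup {m : ℕ} (π : Equiv.Perm (Fin (m + 1))) : (word π).Nodup := by
  rw [word, List.nodup_ofFn]
  exact Fin.val_injective.comp π.injective

theorem word_inj {m : ℕ} {π σ : Equiv.Perm (Fin (m + 1))} (h : word π = word σ) : π = σ := by
  have := List.ofFn_injective h
  ext i
  exact congrFun this i

theorem word_surj {m : ℕ} (π : Equiv.Perm (Fin (m + 1))) (l : List ℕ) (h : (word π).Perm l) :
    ∃ σ : Equiv.Perm (Fin (m + 1)), word σ = l := by
  have hlen : l.length = m + 1 := by rw [← h.length_eq]; simp [word]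
  have hnd : l.Nodup := h.nodup_iff.1 (word_nodup π)
  have hlt : ∀ x ∈ l, x < m + 1 := by
    intro x hx
    have := h.mem_iff.2 hx
    rw [word, List.mem_ofFn] at this
    obtain ⟨i, rfl⟩ := this
    exact (π i).isLt
  let f : Fin (m + 1) → Fin (m + 1) := fun i =>
    ⟨l[i.val]'(by rw [hlen]; exact i.isLt), hlt _ (List.getElem_mem _)⟩
  have hf : Function.Injective f := by
    intro i j hij
    have := congrArg Fin.val hij
    simp only [f] at this
    exact Fin.ext ((hnd.getElem_inj_iff).1 this)
  refine ⟨Equiv.ofBijective f (Finite.injective_iff_bijective.1 hf), ?_⟩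
  apply List.ext_getElem
  · simp [word, hlen]
  · intro i h1 h2
    simp [word, f, -List.ofFn_succ]

theorem mem_Qset_iff {m : ℕ} (π : Equiv.Perm (Fin (m + 1))) : π ∈ Qset m ↔ QL (word π) := by
  have hlen : (word π).length = m + 1 := by simp [word]
  have hget : ∀ (i : ℕ) (h : i < m + 1), (word π)[i]'(by omega) = (π ⟨i, h⟩).val := by
    intro i h; simp [word, -List.ofFn_succ]
  obtain ⟨j, hj⟩ : ∃ j, j = π⁻¹ (Fin.last m) := ⟨_, rfl⟩
  have hπj : π j = Fin.last m := by rw [hj]; simp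
  simp only [Qset, Finset.mem_filter, Finset.mem_univ, true_and, ← hj]
  constructor
  · intro H
    have hjl : j.val < (word π).length := by omega
    refine ⟨(word π).take j, m, (word π).drop (j + 1), ?_, ?_, ?_⟩
    · have h1 : (word π)[j.val] = m := by rw [hget _ j.isLt]; simp [hπj]
      conv_lhs => rw [← List.take_append_drop j (word π), List.drop_eq_getElem_cons hjl, h1]
    · have h1 : (word π)[j.val] = m := by rw [hget _ j.isLt]; simp [hπj]
      have e : (word π).take j ++ [m] = (word π).take (j + 1) := by
        rw [List.take_succ_eq_append_getElem hjl, h1]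
      rw [e, ← List.isChain_iff_pairwise, List.isChain_iff_getElem]
      intro i hi
      simp at hi
      rw [List.getElem_take, List.getElem_take, hget i (by omega), hget (i + 1) (by omega)]
      exact H ⟨i, by omega⟩ (by rw [Fin.le_def]; simp; omega)
    · intro x hx
      obtain ⟨i, hi, rfl⟩ := List.mem_iff_getElem.1 hx
      simp at hi
      rw [List.getElem_drop, hget _ (by omega)]
      have h3 : (π ⟨j + 1 + i, by omega⟩) ≠ Fin.last m := by
        rw [← hπj]
        intro h
        have := congrArg Fin.val (π.injective h)
        simp at this
        omega
      exact Fin.val_lt_last h3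
  · rintro ⟨p, M, w, e, hp, hw⟩ i hi
    have hle : ∀ x ∈ word π, x ≤ M := by
      intro x hx
      rw [e] at hx
      simp at hx
      rcases hx with hx | hx | hx
      · exact ((List.pairwise_append.1 hp).2.2 x hx M (by simp)).le
      · exact hx.le
      · exact (hw x hx).le
    have hpl : p.length < m + 1 := by rw [← hlen, e]; simp
    have hM : (π ⟨p.length, hpl⟩).val = M := by
      rw [← hget _ hpl]; simp [e]
    have hjp : j = ⟨p.length, hpl⟩ := by
      apply π.injective
      rw [hπj]
      apply Fin.ext
      have h1 := hle (π j).val (by rw [word, List.mem_ofFn]; exact ⟨j, rfl⟩)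
      rw [hπj] at h1
      have := (π ⟨p.length, hpl⟩).isLt
      simp at h1 ⊢
      omega
    have hi' : i.val + 1 ≤ p.length := by
      rw [hjp, Fin.le_def] at hi
      simpa using hi
    have e' : word π = (p ++ [M]) ++ w := by simp [e]
    have hlt := List.pairwise_iff_getElem.1 hp i.val (i.val + 1) (by simp; omega)
      (by simp; omega) (by omega)
    have g1 := hget i.val (by omega)
    have g2 := hget (i.val + 1) (by omega)
    simp only [e'] at g1 g2
    rw [List.getElem_append_left (by simp; omega)] at g1 g2
    rw [g1, g2] at hlt
    exact hlt

theorem des_word {m : ℕ} (π : Equiv.Perm (Fin (m + 1))) :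
    des π = cnt (fun a b => b < a) (word π) := by
  rw [word, cnt_ofFn]; rfl

theorem asc_word {m : ℕ} (π : Equiv.Perm (Fin (m + 1))) :
    asc π = cnt (fun a b => a < b) (word π) := by
  rw [word, cnt_ofFn]; rfl

theorem exists_partner {m : ℕ} (π : Equiv.Perm (Fin (m + 1))) (h : π ∈ Qset m) :
    ∃ σ ∈ Qset m, WRel (word π) (word σ) ∧ des σ = asc π ∧ asc σ = des π := by
  obtain ⟨r, hr⟩ := QL.total _ _ rfl (word_nodup π) ((mem_Qset_iff π).1 h)
  obtain ⟨σ, rfl⟩ := word_surj π r hr.perm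
  refine ⟨σ, (mem_Qset_iff σ).2 hr.symm.ql, hr, ?_, ?_⟩
  · rw [des_word, asc_word, hr.cnt_eq.1]
  · rw [des_word, asc_word, hr.cnt_eq.2]

theorem des_asc_equidistributed (n k : ℕ) :
    ((Qset n).filter fun π => des π = k).card
      = ((Qset n).filter fun π => asc π = k).card := by
  apply le_antisymm
  · apply Finset.card_le_card_of_forall_subsingleton (fun π σ => WRel (word π) (word σ))
    · intro π hπ
      obtain ⟨h1, h2⟩ := Finset.mem_filter.1 hπ
      obtain ⟨σ, hσ, hr, -, ha⟩ := exists_partner π h1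
      exact ⟨σ, Finset.mem_filter.2 ⟨hσ, ha.trans h2⟩, hr⟩
    · intro σ _ π1 h1 π2 h2
      exact word_inj (h1.2.symm.unique h2.2.symm)
  · apply Finset.card_le_card_of_forall_subsingleton (fun π σ => WRel (word π) (word σ))
    · intro π hπ
      obtain ⟨h1, h2⟩ := Finset.mem_filter.1 hπ
      obtain ⟨σ, hσ, hr, hd, -⟩ := exists_partner π h1
      exact ⟨σ, Finset.mem_filter.2 ⟨hσ, hd.trans h2⟩, hr⟩
    · intro σ _ π1 h1 π2 h2
      exact word_inj (h1.2.symm.unique h2.2.symm)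
end

section
/- For all integers n ≥ 0 and k ≥ 0, the cardinality of R̄A_{n+2,k} equals the cardinality of RFA_{n+1,k}. -/
open Finset

/-- With `a = π⁻¹(1)` (smallest entry is `0 : Fin (m+1)`, positions `0`-indexed):
either `a` is the last position, or `a` is interior and `π(a-1) < π(a+1)`. -/
def rabarCond {m : ℕ} (π : Equiv.Perm (Fin (m + 1))) : Prop :=
  π⁻¹ 0 = Fin.last m ∨ ∃ j : ℕ, ∃ h : j + 2 ≤ m,
    (π⁻¹ 0 : ℕ) = j + 1 ∧ π ⟨j, by omega⟩ < π ⟨j + 2, by omega⟩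

open scoped Classical in
/-- `R̄A_{m+1,k}`: permutations `π` of `{1, …, m+1}` with `π ∈ 𝒬_{m+1}`, `asc π = k`,
and, with `a = π⁻¹(1)`, either `a = m+1` or `π(a-1) < π(a+1)`. -/
noncomputable def RAbar (m k : ℕ) : Finset (Equiv.Perm (Fin (m + 1))) :=
  (Qset m).filter fun π => asc π = k ∧ rabarCond π

/-- `RFA_{n+1,k}`: pairs `(π, i)` with `π ∈ 𝒬_{n+1}`, `asc π = k`,
`i ∈ {1, …, k} ∪ {n+1}`, and `i > π⁻¹(n+1) - 1`, where `π⁻¹(n+1)` is the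
(`1`-indexed) position of the largest entry. -/
def RFA (n k : ℕ) : Finset (Equiv.Perm (Fin (n + 1)) × ℕ) :=
  (Qset n ×ˢ (Finset.Icc 1 k ∪ {n + 1})).filter fun p =>
    asc p.1 = k ∧ (p.1⁻¹ (Fin.last n) : ℕ) < p.2

/-- One-line notation as a function on naturals. -/
def oneLine {m : ℕ} (π : Equiv.Perm (Fin (m + 1))) (i : ℕ) : ℕ :=
  if h : i < m + 1 then (π ⟨i, h⟩ : ℕ) else 0

lemma oneLine_fin {m : ℕ} (π : Equiv.Perm (Fin (m + 1))) (i : Fin (m + 1)) :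
    oneLine π i = (π i : ℕ) := by
  simp only [oneLine, i.isLt, dite_true]

lemma mem_Qset_iff_s7 {m : ℕ} (π : Equiv.Perm (Fin (m + 1))) :
    π ∈ Qset m ↔ ∀ i : ℕ, i + 1 ≤ (π⁻¹ (Fin.last m) : ℕ) →
      oneLine π i < oneLine π (i + 1) := by
  simp only [Qset, mem_filter, mem_univ, true_and]
  constructor
  · intro h i hi
    have hm : i < m := by
      have := (π⁻¹ (Fin.last m)).isLt
      omega
    have := h ⟨i, hm⟩ (by rw [Fin.le_def]; simpa using hi)
    rw [Fin.lt_def, ← oneLine_fin, ← oneLine_fin] at this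
    simpa using this
  · intro h i hi
    rw [Fin.lt_def, ← oneLine_fin, ← oneLine_fin]
    have := h i (by rw [Fin.le_def] at hi; simpa using hi)
    simpa using this

lemma asc_eq {m : ℕ} (π : Equiv.Perm (Fin (m + 1))) :
    asc π = ((range m).filter fun i => oneLine π i < oneLine π (i + 1)).card := by
  unfold asc
  refine Finset.card_bij (fun i _ => (i : ℕ)) ?_ ?_ ?_
  · intro i hi
    simp only [mem_filter, mem_univ, true_and, mem_range] at hi ⊢
    rw [Fin.lt_def, ← oneLine_fin, ← oneLine_fin] at hi
    exact ⟨i.isLt, by simpa using hi⟩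
  · intro i _ j _ h
    exact Fin.ext h
  · intro i hi
    simp only [mem_filter, mem_range] at hi
    refine ⟨⟨i, hi.1⟩, ?_, rfl⟩
    simp only [mem_filter, mem_univ, true_and]
    rw [Fin.lt_def, ← oneLine_fin, ← oneLine_fin]
    simpa using hi.2

/-- Insert a new minimum at position `c + 1`. -/
def insMin {n : ℕ} (π : Equiv.Perm (Fin (n + 1))) (c : Fin (n + 1)) :
    Equiv.Perm (Fin (n + 2)) :=
  ((finSuccEquiv' c.succ).trans (Equiv.optionCongr π)).trans (finSuccEquiv' 0).symm

lemma insMin_self {n : ℕ} (π : Equiv.Perm (Fin (n + 1))) (c : Fin (n + 1)) :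
    insMin π c c.succ = 0 := by
  simp [insMin]

lemma insMin_succAbove {n : ℕ} (π : Equiv.Perm (Fin (n + 1))) (c i : Fin (n + 1)) :
    insMin π c (c.succ.succAbove i) = (π i).succ := by
  simp [insMin]

lemma insMin_inv_zero {n : ℕ} (π : Equiv.Perm (Fin (n + 1))) (c : Fin (n + 1)) :
    (insMin π c)⁻¹ 0 = c.succ := by
  rw [Equiv.Perm.inv_eq_iff_eq, insMin_self]

lemma insMin_inv_last {n : ℕ} (π : Equiv.Perm (Fin (n + 1))) (c : Fin (n + 1)) :
    ((insMin π c)⁻¹ (Fin.last (n + 1)) : ℕ) =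
      if (π⁻¹ (Fin.last n) : ℕ) ≤ c then (π⁻¹ (Fin.last n) : ℕ)
        else (π⁻¹ (Fin.last n) : ℕ) + 1 := by
  have : (insMin π c)⁻¹ (Fin.last (n + 1)) = c.succ.succAbove (π⁻¹ (Fin.last n)) := by
    rw [Equiv.Perm.inv_eq_iff_eq, insMin_succAbove]
    simp
  rw [this]
  simp only [Fin.succAbove, Fin.lt_def]
  split_ifs <;> simp at * <;> omega

lemma oneLine_insMin {n : ℕ} (π : Equiv.Perm (Fin (n + 1))) (c : Fin (n + 1)) :
    (∀ i : ℕ, i ≤ c → oneLine (insMin π c) i = oneLine π i + 1) ∧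
    oneLine (insMin π c) (c + 1) = 0 ∧
    (∀ i : ℕ, c < i → i < n + 1 → oneLine (insMin π c) (i + 1) = oneLine π i + 1) := by
  have key : ∀ i : Fin (n + 1), oneLine (insMin π c) (c.succ.succAbove i : Fin (n + 2))
      = oneLine π i + 1 := by
    intro i
    rw [oneLine_fin, insMin_succAbove, oneLine_fin]
    simp
  refine ⟨?_, ?_, ?_⟩
  · intro i hi
    have := key ⟨i, by omega⟩
    rw [Fin.succAbove_of_castSucc_lt _ _ (by rw [Fin.lt_def]; simp; omega)] at this
    simpa using this
  · have := oneLine_fin (insMin π c) c.succ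
    rw [insMin_self] at this
    simpa using this
  · intro i hi hn
    have := key ⟨i, hn⟩
    rw [Fin.succAbove_of_le_castSucc _ _ (by rw [Fin.le_def]; simp; omega)] at this
    simpa using this

/-- Position `c` is the last one, or an ascent. -/
def GoodPos {n : ℕ} (π : Equiv.Perm (Fin (n + 1))) (c : ℕ) : Prop :=
  c < n → oneLine π c < oneLine π (c + 1)

lemma rabarCond_insMin {n : ℕ} (π : Equiv.Perm (Fin (n + 1))) (c : Fin (n + 1)) :
    rabarCond (insMin π c) ↔ GoodPos π c := by
  obtain ⟨h1, h2, h3⟩ := oneLine_insMin π c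
  have hc := c.isLt
  unfold rabarCond GoodPos
  rw [insMin_inv_zero]
  constructor
  · rintro (h | ⟨j, hj, h, hlt⟩) hcn
    · have := congrArg Fin.val h
      simp at this
      omega
    · simp at h
      rw [Fin.lt_def, ← oneLine_fin, ← oneLine_fin] at hlt
      simp only at hlt
      have a1 := h1 j (by omega)
      have a2 : oneLine (insMin π c) (j + 2) = _ := h3 (j + 1) (by omega) (by omega)
      subst h
      omega
  · intro h
    by_cases hcn : (c : ℕ) < n
    · right
      refine ⟨c, by omega, by simp, ?_⟩
      rw [Fin.lt_def, ← oneLine_fin, ← oneLine_fin]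
      simp only
      have a1 := h1 c le_rfl
      have a2 : oneLine (insMin π c) (c + 2) = _ := h3 (c + 1) (by omega) (by omega)
      have := h hcn
      omega
    · left
      ext
      simp
      omega

lemma Qset_insMin {n : ℕ} (π : Equiv.Perm (Fin (n + 1))) (c : Fin (n + 1)) :
    insMin π c ∈ Qset (n + 1) ↔ π ∈ Qset n ∧ (π⁻¹ (Fin.last n) : ℕ) ≤ c := by
  obtain ⟨h1, h2, h3⟩ := oneLine_insMin π c
  rw [mem_Qset_iff_s7, mem_Qset_iff_s7, insMin_inv_last]
  by_cases hp : (π⁻¹ (Fin.last n) : ℕ) ≤ c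
  · simp only [hp, if_true, and_true]
    refine forall_congr' fun i => forall_congr' fun hi => ?_
    rw [h1 i (by omega), h1 (i + 1) (by omega)]
    omega
  · simp only [hp, if_false, and_false, iff_false]
    intro h
    have := h c (by omega)
    omega

lemma asc_insMin {n : ℕ} (π : Equiv.Perm (Fin (n + 1))) (c : Fin (n + 1))
    (hg : GoodPos π c) : asc (insMin π c) = asc π := by
  obtain ⟨h1, h2, h3⟩ := oneLine_insMin π c
  have hc := c.isLt
  unfold GoodPos at hg
  rw [asc_eq, asc_eq]
  symm
  refine Finset.card_nbij' (fun i => if i < (c : ℕ) then i else i + 1)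
    (fun i => if i < (c : ℕ) then i else i - 1) ?_ ?_ ?_ ?_
  · intro i hi
    simp only [mem_coe, mem_filter, mem_range] at hi ⊢
    split_ifs with hic
    · rw [h1 i (by omega), h1 (i + 1) (by omega)]
      omega
    · refine ⟨by omega, ?_⟩
      rw [h3 (i + 1) (by omega) (by omega)]
      rcases Nat.lt_or_ge (c : ℕ) i with h | h
      · rw [h3 i (by omega) (by omega)]
        omega
      · have : i = c := by omega
        subst this
        omega
  · intro i hi
    simp only [mem_coe, mem_filter, mem_range] at hi ⊢
    split_ifs with hic
    · rw [h1 i (by omega), h1 (i + 1) (by omega)] at hi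
      omega
    · have hne : i ≠ c := by
        rintro rfl
        omega
      obtain ⟨j, rfl⟩ : ∃ j, i = j + 1 := ⟨i - 1, by omega⟩
      simp only [Nat.add_sub_cancel]
      refine ⟨by omega, ?_⟩
      rcases Nat.lt_or_ge (c : ℕ) j with h | h
      · rw [h3 j (by omega) (by omega), h3 (j + 1) (by omega) (by omega)] at hi
        omega
      · have : j = c := by omega
        subst this
        exact hg (by omega)
  · intro i _
    simp only
    split_ifs <;> omega
  · intro i hi
    simp only [mem_coe, mem_filter, mem_range] at hi ⊢
    have hne : i ≠ c := by
      rintro rfl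
      omega
    split_ifs <;> omega

lemma insMin_inj {n : ℕ} {π π' : Equiv.Perm (Fin (n + 1))} {c c' : Fin (n + 1)}
    (h : insMin π c = insMin π' c') : π = π' ∧ c = c' := by
  have hc : c = c' := by
    have := insMin_inv_zero π c
    rw [h, insMin_inv_zero] at this
    exact (Fin.succ_injective _ this).symm
  subst hc
  refine ⟨?_, rfl⟩
  ext1 i
  have := insMin_succAbove π c i
  rw [h, insMin_succAbove] at this
  exact (Fin.succ_injective _ this).symm

lemma insMin_surj {n : ℕ} (σ : Equiv.Perm (Fin (n + 2))) (h0 : σ⁻¹ 0 ≠ 0) :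
    ∃ π c, insMin π c = σ := by
  obtain ⟨c, hc⟩ := Fin.exists_succ_eq.2 h0
  have hσ : σ c.succ = 0 := by rw [hc]; simp
  have hex : ∀ i : Fin (n + 1), ∃ v : Fin (n + 1), v.succ = σ (c.succ.succAbove i) := by
    intro i
    apply Fin.exists_succ_eq.2
    rw [← hσ]
    intro h
    exact Fin.succAbove_ne _ _ (σ.injective h)
  choose f hf using hex
  have finj : Function.Injective f := by
    intro i j hij
    have : σ (c.succ.succAbove i) = σ (c.succ.succAbove j) := by rw [← hf, ← hf, hij]
    exact Fin.succAbove_right_injective (σ.injective this)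
  refine ⟨Equiv.ofBijective f (Finite.injective_iff_bijective.1 finj), c, ?_⟩
  ext1 x
  rcases Fin.eq_self_or_eq_succAbove c.succ x with rfl | ⟨i, rfl⟩
  · rw [insMin_self, hσ]
  · rw [insMin_succAbove, ← hf]
    rfl

lemma rabarCond_ne {m : ℕ} (σ : Equiv.Perm (Fin (m + 2))) (h : rabarCond σ) :
    σ⁻¹ 0 ≠ 0 := by
  rintro h0
  rcases h with h | ⟨j, hj, h, -⟩
  · rw [h0] at h
    have := congrArg Fin.val h
    simp at this
  · rw [h0] at h
    simp at h

open scoped Classical in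
lemma card_fiber {n k : ℕ} (π : Equiv.Perm (Fin (n + 1))) (hQ : π ∈ Qset n)
    (hk : asc π = k) :
    (univ.filter fun c : Fin (n + 1) =>
      GoodPos π c ∧ (π⁻¹ (Fin.last n) : ℕ) ≤ c).card =
    ((Icc 1 k ∪ {n + 1}).filter fun i => (π⁻¹ (Fin.last n) : ℕ) < i).card := by
  rw [mem_Qset_iff_s7] at hQ
  rw [asc_eq] at hk
  have hp := (π⁻¹ (Fin.last n)).isLt
  generalize (π⁻¹ (Fin.last n) : ℕ) = p at *
  have hkn : k ≤ n := by
    rw [← hk]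
    exact (card_filter_le _ _).trans (by simp)
  -- the ascents split into those before `p` and those after
  have hsplit : k = p + ((range n).filter fun i =>
      oneLine π i < oneLine π (i + 1) ∧ p ≤ i).card := by
    rw [← hk, ← Finset.card_filter_add_card_filter_not (fun i => i < p), filter_filter,
      filter_filter]
    congr 1
    · rw [show ((range n).filter fun i => oneLine π i < oneLine π (i + 1) ∧ i < p) = range p from ?_,
        card_range]
      ext i
      simp only [mem_filter, mem_range]
      constructor
      · tauto
      · intro h
        exact ⟨by omega, hQ i (by omega), h⟩
    · simp only [not_lt]
  have hR : ((Icc 1 k ∪ {n + 1}).filter fun i => p < i) = insert (n + 1) (Ioc p k) := by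
    ext i
    simp only [mem_filter, mem_union, mem_Icc, mem_singleton, mem_insert, mem_Ioc]
    omega
  rw [hR, card_insert_of_notMem (by simp; omega), Nat.card_Ioc]
  have hL : (univ.filter fun c : Fin (n + 1) => GoodPos π c ∧ p ≤ c).card =
      (insert n ((range n).filter fun i =>
        oneLine π i < oneLine π (i + 1) ∧ p ≤ i)).card := by
    refine Finset.card_bij (fun i _ => (i : ℕ)) ?_ ?_ ?_
    · intro i hi
      have := i.isLt
      simp only [mem_filter, mem_univ, true_and, mem_range, mem_insert] at hi ⊢
      by_cases h : (i : ℕ) < n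
      · exact Or.inr ⟨h, hi.1 h, hi.2⟩
      · left; omega
    · intro i _ j _ h
      exact Fin.ext h
    · intro i hi
      simp only [mem_filter, mem_range, mem_insert] at hi
      refine ⟨⟨i, by omega⟩, ?_, rfl⟩
      simp only [mem_filter, mem_univ, true_and]
      unfold GoodPos
      omega
  rw [hL, card_insert_of_notMem (by simp)]
  omega

theorem card_RAbar_eq_card_RFA (n k : ℕ) :
    (RAbar (n + 1) k).card = (RFA n k).card := by
  classical
  set A := (Qset n).filter fun π => asc π = k with hA
  have h1 : (RAbar (n + 1) k).card = (A.sigma fun π => univ.filter fun c : Fin (n + 1) =>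
      GoodPos π c ∧ (π⁻¹ (Fin.last n) : ℕ) ≤ c).card := by
    symm
    refine Finset.card_bij (fun x _ => insMin x.1 x.2) ?_ ?_ ?_
    · rintro ⟨π, c⟩ h
      simp only [hA, mem_sigma, mem_filter, mem_univ, true_and] at h
      simp only [RAbar, mem_filter, Qset_insMin, rabarCond_insMin]
      rw [asc_insMin π c h.2.1]
      tauto
    · rintro ⟨π, c⟩ _ ⟨π', c'⟩ _ h
      obtain ⟨rfl, rfl⟩ := insMin_inj h
      rfl
    · intro σ h
      simp only [RAbar, mem_filter] at h
      obtain ⟨π, c, rfl⟩ := insMin_surj σ (rabarCond_ne σ h.2.2)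
      refine ⟨⟨π, c⟩, ?_, rfl⟩
      rw [Qset_insMin, rabarCond_insMin] at h
      rw [asc_insMin π c h.2.2] at h
      simp only [hA, mem_sigma, mem_filter, mem_univ, true_and]
      tauto
  have h2 : (RFA n k).card = (A.sigma fun π =>
      (Icc 1 k ∪ {n + 1}).filter fun i => (π⁻¹ (Fin.last n) : ℕ) < i).card := by
    refine Finset.card_bij (fun x _ => ⟨x.1, x.2⟩) ?_ ?_ ?_
    · rintro ⟨π, i⟩ h
      simp only [RFA, hA, mem_sigma, mem_filter, mem_product] at h ⊢
      tauto
    · rintro ⟨π, c⟩ _ ⟨π', c'⟩ _ h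
      simpa using h
    · rintro ⟨π, i⟩ h
      refine ⟨(π, i), ?_, rfl⟩
      simp only [RFA, hA, mem_sigma, mem_filter, mem_product] at h ⊢
      tauto
  rw [h1, h2, card_sigma, card_sigma]
  refine Finset.sum_congr rfl fun π hπ => ?_
  rw [hA, mem_filter] at hπ
  exact card_fiber π hπ.1 hπ.2
end

section
/- For every integer n ≥ 0, Σ_{σ ∈ 𝒬̂_{n+1}} x^{exc(σ)}·(−1)^{cyc(σ)+fcyc(σ)} = (−1)^n·(1 + x + x² + ⋯ + x^n), as an identity of polynomials in x with integer coefficients. -/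
open Finset Polynomial

/-- `exc(σ)`: the number of excedances of `σ`. -/
def exc {n : ℕ} (σ : Equiv.Perm (Fin n)) : ℕ :=
  (Finset.univ.filter fun i => i < σ i).card

/-- `fixp(σ)`: the number of fixed points of `σ`. -/
def fixp {n : ℕ} (σ : Equiv.Perm (Fin n)) : ℕ :=
  (Finset.univ.filter fun i => σ i = i).card

/-- `cyc(σ)`: the number of cycles of `σ`, fixed points counted. -/
def cyc {n : ℕ} (σ : Equiv.Perm (Fin n)) : ℕ :=
  σ.cycleType.card + fixp σ

/-- `𝒬̂_{m+1}`: permutations `σ` of `{1, …, m+1}` such that every element `x` other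
than the largest element in the cycle of `σ` containing the largest element
satisfies `σ(x) > x`. -/
noncomputable def Qhat (m : ℕ) : Finset (Equiv.Perm (Fin (m + 1))) :=
  Finset.univ.filter fun σ =>
    ∀ x, σ.SameCycle x (Fin.last m) → x ≠ Fin.last m → x < σ x

/-- `fcyc(σ)`: the number of elements of the cycle of `σ` containing the largest
element. -/
noncomputable def fcyc {m : ℕ} (σ : Equiv.Perm (Fin (m + 1))) : ℕ :=
  (Finset.univ.filter fun x => σ.SameCycle x (Fin.last m)).card

lemma neg_one_pow_cyc {n : ℕ} (σ : Equiv.Perm (Fin n)) :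
    (-1 : ℤ[X]) ^ cyc σ = (-1) ^ n * ((Equiv.Perm.sign σ : ℤ) : ℤ[X]) := by
  have h1 : σ.cycleType.sum + fixp σ = n := by
    rw [Equiv.Perm.sum_cycleType]
    have := Finset.card_filter_add_card_filter_not (s := (Finset.univ : Finset (Fin n)))
      (fun i => σ i = i)
    simp only [Finset.card_univ, Fintype.card_fin] at this
    have h2 : σ.support = Finset.univ.filter (fun i => ¬ σ i = i) := by
      ext i; simp
    rw [h2, fixp]; omega
  rw [Equiv.Perm.sign_of_cycleType, cyc]
  have h3 : (-1 : ℤ[X]) ^ n = (-1) ^ (σ.cycleType.sum + fixp σ) := congrArg _ h1.symm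
  rw [h3]
  push_cast
  rw [← pow_add]
  have : σ.cycleType.sum + fixp σ + (σ.cycleType.sum + σ.cycleType.card)
    = (σ.cycleType.card + fixp σ) + 2 * σ.cycleType.sum := by ring
  rw [this, pow_add _ _ (2 * _), pow_mul]; simp

lemma sameCycle_mem {α : Type*} [Finite α] (σ : Equiv.Perm α) (K : α → Prop)
    (hK : ∀ x, K x → K (σ x)) {x y : α} (hx : K x) (h : σ.SameCycle x y) : K y := by
  obtain ⟨i, hi⟩ := h.exists_nat_pow_eq
  rw [← hi]
  clear hi
  induction i with
  | zero => simpa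
  | succ k ih => rw [pow_succ', Equiv.Perm.mul_apply]; exact hK _ ih

lemma sameCycle_insert {α : Type*} [Finite α] [DecidableEq α] (τ : Equiv.Perm α) (a l : α)
    (hal : a ≠ l) (ha : τ a = a) (x : α) :
    (τ * Equiv.swap l a).SameCycle x l ↔ x = a ∨ τ.SameCycle x l := by
  have e1 : (τ * Equiv.swap l a) l = a := by simp [ha]
  have e2 : (τ * Equiv.swap l a) a = τ l := by simp
  have e3 : ∀ y, y ≠ l → y ≠ a → (τ * Equiv.swap l a) y = τ y := by
    intro y h1 h2
    simp [Equiv.swap_apply_of_ne_of_ne h1 h2]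
  constructor
  · intro h
    refine sameCycle_mem (τ * Equiv.swap l a) (fun x => x = a ∨ τ.SameCycle x l) ?_
      (Or.inr (Equiv.Perm.SameCycle.refl _ _)) h.symm
    intro y hy
    by_cases h1 : y = l
    · subst h1; left; exact e1
    by_cases h2 : y = a
    · subst h2; right; rw [e2]; exact Equiv.Perm.sameCycle_apply_left.2 (Equiv.Perm.SameCycle.refl _ _)
    rw [e3 y h1 h2]
    right
    exact Equiv.Perm.sameCycle_apply_left.2 (hy.resolve_left h2)
  · rintro (h | h)
    · subst h
      rw [← Equiv.Perm.sameCycle_apply_right, e1]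
    · refine sameCycle_mem τ (fun x => (τ * Equiv.swap l a).SameCycle x l) ?_
        (Equiv.Perm.SameCycle.refl _ _) h.symm
      intro y hy
      by_cases h1 : y = l
      · subst h1; rw [← e2, Equiv.Perm.sameCycle_apply_left]
        have h3 : (τ * Equiv.swap y a).SameCycle ((τ * Equiv.swap y a) y) y :=
          Equiv.Perm.sameCycle_apply_left.2 hy
        rwa [e1] at h3
      by_cases h2 : y = a
      · subst h2; rw [ha]; exact hy
      rw [← e3 y h1 h2, Equiv.Perm.sameCycle_apply_left]; exact hy

noncomputable def wt {n : ℕ} (σ : Equiv.Perm (Fin (n + 1))) : ℤ[X] :=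
  X ^ exc σ * (-1) ^ (cyc σ + fcyc σ)

lemma wt_insert {n : ℕ} (τ : Equiv.Perm (Fin (n + 1))) (a : Fin (n + 1))
    (hal : a ≠ Fin.last n) (ha : τ a = a) (hlt : a < τ (Fin.last n)) :
    wt (τ * Equiv.swap (Fin.last n) a) = X * wt τ := by
  have hf : fcyc (τ * Equiv.swap (Fin.last n) a) = fcyc τ + 1 := by
    unfold fcyc
    rw [← Finset.card_insert_of_notMem (a := a)]
    · congr 1
      ext x
      simp [sameCycle_insert τ a _ hal ha]
    · simp only [Finset.mem_filter, Finset.mem_univ, true_and]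
      intro h
      exact hal (sameCycle_mem τ (fun x => x = a) (by rintro x rfl; exact ha) rfl h).symm
  have he : exc (τ * Equiv.swap (Fin.last n) a) = exc τ + 1 := by
    unfold exc
    rw [← Finset.card_insert_of_notMem (a := a)]
    · congr 1
      ext x
      simp only [Finset.mem_filter, Finset.mem_univ, true_and, Finset.mem_insert]
      by_cases h1 : x = Fin.last n
      · subst h1
        simp [ha, hal.symm, (Fin.le_last a).not_gt, (Fin.le_last (τ (Fin.last n))).not_gt]
      by_cases h2 : x = a
      · subst h2; simp [hlt]
      simp [Equiv.swap_apply_of_ne_of_ne h1 h2, h2]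
    · simp [ha]
  unfold wt
  rw [pow_add, pow_add, neg_one_pow_cyc, neg_one_pow_cyc, hf, he, Equiv.Perm.sign_mul,
    Equiv.Perm.sign_swap hal.symm]
  push_cast
  ring

lemma mem_Qhat_insert {n : ℕ} (τ : Equiv.Perm (Fin (n + 1))) (a : Fin (n + 1))
    (hal : a ≠ Fin.last n) (ha : τ a = a) :
    τ * Equiv.swap (Fin.last n) a ∈ Qhat n ↔ τ ∈ Qhat n ∧ a < τ (Fin.last n) := by
  have hna : ¬ τ.SameCycle a (Fin.last n) := fun h =>
    hal (sameCycle_mem τ (fun x => x = a) (by rintro x rfl; exact ha) rfl h).symm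
  simp only [Qhat, Finset.mem_filter, Finset.mem_univ, true_and, sameCycle_insert τ a _ hal ha]
  constructor
  · intro h
    constructor
    · intro x hx hxl
      have := h x (Or.inr hx) hxl
      have hxa : x ≠ a := by rintro rfl; exact hna hx
      simpa [Equiv.swap_apply_of_ne_of_ne hxl hxa] using this
    · simpa using h a (Or.inl rfl) hal
  · rintro ⟨h, hlt⟩ x hx hxl
    by_cases hxa : x = a
    · subst hxa; simpa using hlt
    · simpa [Equiv.swap_apply_of_ne_of_ne hxl hxa] using h x (hx.resolve_left hxa) hxl

def fixlt {n : ℕ} (a : ℕ) (σ : Equiv.Perm (Fin (n + 1))) : ℕ :=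
  (Finset.univ.filter fun i : Fin (n + 1) => i.val < a ∧ σ i = i).card

noncomputable def W (n a : ℕ) : ℤ[X] :=
  ∑ σ ∈ (Qhat n).filter (fun σ => a ≤ (σ (Fin.last n)).val), wt σ * (1 + X) ^ fixlt a σ

lemma fixlt_succ {n : ℕ} (a : Fin (n + 1)) (σ : Equiv.Perm (Fin (n + 1))) :
    fixlt (a.val + 1) σ = fixlt a.val σ + if σ a = a then 1 else 0 := by
  unfold fixlt
  split_ifs with h
  · rw [← Finset.card_insert_of_notMem (a := a)]
    · congr 1
      ext x
      simp only [Finset.mem_filter, Finset.mem_univ, true_and, Finset.mem_insert]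
      by_cases hx : x = a
      · subst hx; simp [h]
      · have : x.val ≠ a.val := fun h => hx (Fin.ext h)
        simp only [hx, false_or, and_congr_left_iff]; omega
    · simp
  · rw [add_zero]
    congr 1
    ext x
    simp only [Finset.mem_filter, Finset.mem_univ, true_and]
    by_cases hx : x = a
    · subst hx; simp [h]
    · have : x.val ≠ a.val := fun h => hx (Fin.ext h)
      simp only [and_congr_left_iff]; omega

lemma W_step (n a : ℕ) (han : a < n) : W n a = W n (a + 1) := by
  obtain ⟨b, rfl⟩ : ∃ b : Fin (n + 1), a = b.val := ⟨⟨a, by omega⟩, rfl⟩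
  have hbl : b ≠ Fin.last n := by rintro rfl; simp at han
  have hsplit : W n b.val =
      ∑ σ ∈ (Qhat n).filter (fun σ => b.val + 1 ≤ (σ (Fin.last n)).val),
        wt σ * (1 + X) ^ fixlt b.val σ +
      ∑ σ ∈ (Qhat n).filter (fun σ => σ (Fin.last n) = b),
        wt σ * (1 + X) ^ fixlt b.val σ := by
    unfold W
    rw [← Finset.sum_union]
    · congr 1
      ext σ
      simp only [Finset.mem_filter, Finset.mem_union, Fin.ext_iff]
      rw [← and_or_left]
      apply and_congr_right
      intro _; omega
    · rw [Finset.disjoint_left]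
      intro σ h1 h2
      simp only [Finset.mem_filter] at h1 h2
      rw [h2.2] at h1; omega
  have hbij : ∑ σ ∈ (Qhat n).filter (fun σ => σ (Fin.last n) = b),
        wt σ * (1 + X) ^ fixlt b.val σ =
      ∑ τ ∈ ((Qhat n).filter (fun σ => b.val + 1 ≤ (σ (Fin.last n)).val)).filter
        (fun τ => τ b = b), X * (wt τ * (1 + X) ^ fixlt b.val τ) := by
    symm
    refine Finset.sum_bij' (fun τ _ => τ * Equiv.swap (Fin.last n) b)
      (fun σ _ => σ * Equiv.swap (Fin.last n) b) ?_ ?_ ?_ ?_ ?_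
    · intro τ hτ
      simp only [Finset.mem_filter] at hτ ⊢
      obtain ⟨⟨h1, h2⟩, h3⟩ := hτ
      refine ⟨(mem_Qhat_insert τ b hbl h3).2 ⟨h1, Fin.lt_def.2 h2⟩, by simp [h3]⟩
    · intro σ hσ
      simp only [Finset.mem_filter] at hσ ⊢
      obtain ⟨h1, h2⟩ := hσ
      have h3 : (σ * Equiv.swap (Fin.last n) b) b = b := by simp [h2]
      have h4 := mem_Qhat_insert (σ * Equiv.swap (Fin.last n) b) b hbl h3
      rw [mul_assoc, Equiv.swap_mul_self, mul_one] at h4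
      have h5 := h4.1 h1
      exact ⟨⟨h5.1, Fin.lt_def.1 h5.2⟩, h3⟩
    · intro τ _; simp [mul_assoc]
    · intro τ _; simp [mul_assoc]
    · intro τ hτ
      simp only [Finset.mem_filter] at hτ
      obtain ⟨⟨h1, h2⟩, h3⟩ := hτ
      rw [wt_insert τ b hbl h3 (Fin.lt_def.2 h2)]
      have : fixlt b.val (τ * Equiv.swap (Fin.last n) b) = fixlt b.val τ := by
        unfold fixlt
        congr 1
        ext x
        simp only [Finset.mem_filter, Finset.mem_univ, true_and]
        apply and_congr_right
        intro hx
        have hx1 : x ≠ Fin.last n := by rintro rfl; simp at hx; omega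
        have hx2 : x ≠ b := by rintro rfl; simp at hx
        simp [Equiv.swap_apply_of_ne_of_ne hx1 hx2]
      rw [this]; ring
  rw [hsplit, hbij, Finset.sum_filter (p := fun τ : Equiv.Perm (Fin (n + 1)) => τ b = b),
    ← Finset.sum_add_distrib]
  unfold W
  refine Finset.sum_congr rfl fun σ _ => ?_
  rw [fixlt_succ]
  split_ifs <;> ring

noncomputable def A (n : ℕ) : Matrix (Fin (n + 1)) (Fin (n + 1)) ℤ[X] := fun i j =>
  if j = Fin.last n then (if i = j then 1 else 0)
  else if j < i then X else if i = j then 1 + X else 1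

lemma det_A (n : ℕ) : (A n).det = ∑ i ∈ Finset.range (n + 1), (X : ℤ[X]) ^ i := by
  induction n with
  | zero => simp [A]
  | succ n ih =>
    let r : Fin (n + 2) → ℤ[X] := fun j => if j = Fin.last (n + 1) then 0 else 1
    have hrow : A (n + 1) = (A (n + 1)).updateRow 0 (X • (Pi.single 0 1) + r) := by
      ext1 i j
      by_cases hi : i = 0
      · subst hi
        rw [Matrix.updateRow_self]
        by_cases hj : j = Fin.last (n + 1)
        · subst hj; simp [A, r, Fin.ext_iff]
        · by_cases hj0 : j = 0
          · subst hj0; simp [A, r, Fin.ext_iff]; ring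
          · simp [A, r, hj, hj0, Ne.symm hj0]
      · rw [Matrix.updateRow_ne hi]
    rw [hrow, Matrix.det_updateRow_add, Matrix.det_updateRow_smul]
    have h1 : ((A (n + 1)).updateRow 0 (Pi.single 0 1)).det = (A n).det := by
      rw [Matrix.det_succ_row_zero, Fin.sum_univ_succ]
      have hs : (((A (n + 1)).updateRow 0 (Pi.single 0 1)).submatrix Fin.succ
          (Fin.succAbove 0)) = A n := by
        ext1 i j
        simp [A, Matrix.submatrix_apply, Matrix.updateRow_ne, ← Fin.succ_last]
      rw [hs]
      simp
    have h2 : ((A (n + 1)).updateRow 0 r).det = 1 := by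
      let B : Matrix (Fin (n + 2)) (Fin (n + 2)) ℤ[X] := fun i j =>
        if i = 0 then r j else A (n + 1) i j - X * r j
      have : ((A (n + 1)).updateRow 0 r).det = B.det := by
        refine Matrix.det_eq_of_forall_row_eq_smul_add_const
          (fun i => if i = 0 then 0 else X) 0 (by simp) ?_
        intro i j
        by_cases hi : i = 0
        · subst hi; simp [B]
        · simp [B, hi, Matrix.updateRow_ne]
      rw [this, Matrix.det_of_isUpperTriangular]
      · apply Finset.prod_eq_one
        intro i _
        by_cases hi : i = 0
        · subst hi
          have h0 : (0 : Fin (n + 2)) ≠ Fin.last (n + 1) := by simp [Fin.ext_iff]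
          simp only [B, r, if_true, if_neg h0]
        · by_cases hl : i = Fin.last (n + 1)
          · subst hl; simp [B, r, A]
          · simp [B, hi, r, A, hl]
      · intro i j hij
        have hij : j < i := hij
        have hi : i ≠ 0 := by rintro rfl; simp at hij
        have hj : j ≠ Fin.last (n + 1) := by rintro rfl; exact absurd hij (not_lt.2 (Fin.le_last _))
        simp [B, hi, r, A, hj, hij]
    rw [h1, h2, ih, Finset.sum_range_succ' _ (n + 1), Finset.mul_sum]
    simp [pow_succ']

lemma W_last (n : ℕ) : W n n = (-1) ^ n * (A n).det := by
  rw [Matrix.det_apply', Finset.mul_sum]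
  unfold W
  refine Finset.sum_subset_zero_on_sdiff (Finset.subset_univ _) ?_ ?_
  · intro σ hσ
    have hne : σ (Fin.last n) ≠ Fin.last n := by
      intro h
      simp only [Finset.mem_sdiff, Finset.mem_univ, true_and, Finset.mem_filter, h, Fin.val_last,
        le_refl, and_true, Qhat] at hσ
      apply hσ
      intro x hx hxl
      exact absurd (sameCycle_mem σ (fun x => x = Fin.last n) (by rintro x rfl; exact h) rfl
        hx.symm) hxl
    rw [Finset.prod_eq_zero (Finset.mem_univ (Fin.last n))]
    · simp
    · simp [A, hne]
  · intro σ hσ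
    have h : σ (Fin.last n) = Fin.last n := by
      simp only [Finset.mem_filter] at hσ
      apply Fin.ext
      have := (σ (Fin.last n)).isLt
      simp only [Fin.val_last]; omega
    have hf : fcyc σ = 1 := by
      unfold fcyc
      rw [Finset.card_eq_one]
      refine ⟨Fin.last n, ?_⟩
      ext x
      simp only [Finset.mem_filter, Finset.mem_univ, true_and, Finset.mem_singleton]
      constructor
      · intro hx
        exact sameCycle_mem σ (fun x => x = Fin.last n) (by rintro x rfl; exact h) rfl hx.symm
      · rintro rfl; exact Equiv.Perm.SameCycle.refl _ _
    have hp : ∏ i, A n (σ i) i = X ^ exc σ * (1 + X) ^ fixlt n σ := by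
      unfold exc fixlt
      rw [← Finset.prod_const, ← Finset.prod_const, Finset.prod_filter, Finset.prod_filter,
        ← Finset.prod_mul_distrib]
      refine Finset.prod_congr rfl fun i _ => ?_
      by_cases hi : i = Fin.last n
      · subst hi; simp [A, h]
      · have hin : i.val < n := by
          have := i.isLt
          have : i.val ≠ n := fun hh => hi (Fin.ext hh)
          omega
        by_cases h1 : i < σ i
        · simp [A, hi, h1, h1.ne']
        · simp [A, hi, h1, hin]
    rw [hp, wt, pow_add, neg_one_pow_cyc, hf]
    ring

theorem sum_exc_cyc_fcyc_sign (n : ℕ) :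
    ∑ σ ∈ Qhat n, (X : Polynomial ℤ) ^ exc σ * (-1) ^ (cyc σ + fcyc σ)
      = (-1) ^ n * ∑ i ∈ Finset.range (n + 1), (X : Polynomial ℤ) ^ i := by
  have h0 : ∑ σ ∈ Qhat n, (X : Polynomial ℤ) ^ exc σ * (-1) ^ (cyc σ + fcyc σ) = W n 0 := by
    unfold W
    simp [fixlt, wt]
  have hk : ∀ k, k ≤ n → W n 0 = W n k := by
    intro k
    induction k with
    | zero => intro _; rfl
    | succ k ih => intro hk; rw [ih (by omega), W_step n k (by omega)]
  rw [h0, hk n le_rfl, W_last, det_A]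
end

section
/- For all integers n ≥ 0 and 0 ≤ k ≤ n, the Betti number B(n,k) = Σ_{i=k}^{n} (−1)^{k−i}·2^{n−i}·C(n,i) satisfies B(n,k) = Σ (−1)^{cyc(π)+aexc(π)}, where the sum is over all permutations π ∈ 𝒬̂_{n+1} with exc(π) = n−k, and C(n,i) is the binomial coefficient. -/
open Finset

/-- `aexc(σ)`: the number of anti-excedances of `σ`, i.e. indices `i` with `σ(i) ≤ i`. -/
def aexc {n : ℕ} (σ : Equiv.Perm (Fin n)) : ℕ :=
  (Finset.univ.filter fun i => σ i ≤ i).card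

/-- The Betti number `B(n,k) = Σ_{i=k}^{n} (−1)^{k−i} 2^{n−i} C(n,i)`;
for `i ≥ k` one has `(−1)^{k−i} = (−1)^{i−k}`. -/
def BettiB (n k : ℕ) : ℤ :=
  ∑ i ∈ Finset.Icc k n, (-1 : ℤ) ^ (i - k) * 2 ^ (n - i) * n.choose i

open Polynomial in
/-- Weight matrix attached to a candidate cycle set `T` of the last element. -/
noncomputable def wMat {n : ℕ} (T : Finset (Fin (n + 1))) :
    Matrix (Fin (n + 1)) (Fin (n + 1)) (Polynomial ℤ) :=
  fun i j => if i ∈ T then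
      (if j ∈ T then (if i = Fin.last n then 1 else if i < j then -X else 0) else 0)
    else (if j ∈ T then 0 else if i < j then -X else 1)

theorem sign_weight {n : ℕ} (σ : Equiv.Perm (Fin n)) :
    (-1 : ℤ) ^ (cyc σ + aexc σ) = (Equiv.Perm.sign σ : ℤ) * (-1) ^ exc σ := by
  have h1 : exc σ + aexc σ = n := by
    have := Finset.card_filter_add_card_filter_not (s := (Finset.univ : Finset (Fin n)))
      (fun i => i < σ i)
    simp only [not_lt, Finset.card_univ, Fintype.card_fin] at this
    exact this
  have h2 : fixp σ + σ.support.card = n := by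
    have := Finset.card_filter_add_card_filter_not (s := (Finset.univ : Finset (Fin n)))
      (fun i => σ i = i)
    simp only [Finset.card_univ, Fintype.card_fin] at this
    exact this
  rw [Equiv.Perm.sign_of_cycleType, Equiv.Perm.sum_cycleType]
  push_cast
  rw [← pow_add]
  unfold cyc
  rw [neg_one_pow_eq_pow_mod_two, neg_one_pow_eq_pow_mod_two (n := _ + exc σ)]
  congr 1
  omega

open Polynomial in
theorem det_M (m : ℕ) :
    (Matrix.of fun i j : Fin (m + 1) => if i < j then (-X : Polynomial ℤ) else 1).det
      = (1 + X) ^ m := by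
  let B : Matrix (Fin (m + 1)) (Fin (m + 1)) (Polynomial ℤ) :=
    fun i j => if i = 0 then (if i < j then -X else 1) else (if i = j then 1 + X else 0)
  rw [Matrix.det_eq_of_forall_row_eq_smul_add_pred (B := B) (fun _ => 1)]
  · rw [Matrix.det_of_isUpperTriangular]
    · rw [Fin.prod_univ_succ]
      simp [B]
    · intro i j hij
      simp only [id] at hij
      have : i ≠ 0 := by rintro rfl; exact absurd hij (by simp)
      simp [B, this, hij.ne']
  · intro j; simp [B]
  · intro i j
    simp only [Matrix.of_apply, B, Fin.succ_ne_zero, if_false]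
    simp only [Fin.lt_def, Fin.ext_iff, Fin.val_succ, Fin.val_castSucc]
    split_ifs <;> first | omega | ring

open Polynomial in
theorem det_A_s16 (m : ℕ) :
    (Matrix.of fun i j : Fin (m + 1) => if i = Fin.last m then (1 : Polynomial ℤ)
      else if i < j then -X else 0).det = X ^ m := by
  rw [Matrix.det_succ_column_zero, Finset.sum_eq_single (Fin.last m)]
  · rw [Matrix.det_of_isUpperTriangular]
    · simp [Fin.castSucc_lt_succ, (Fin.castSucc_lt_last _).ne, ← mul_pow]
    · intro i j hij
      simp only [id] at hij
      have h1 : ¬ i.castSucc < j.succ := by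
        rw [Fin.lt_def] at hij ⊢
        simp only [Fin.val_succ, Fin.val_castSucc]
        omega
      simp only [Matrix.submatrix_apply, Matrix.of_apply, Fin.succAbove_last,
        (Fin.castSucc_lt_last _).ne, if_false, h1]
  · intro i _ hi
    simp [hi]
  · simp

open Polynomial in
theorem det_wMat {n : ℕ} (T : Finset (Fin (n + 1))) (hT : Fin.last n ∈ T) :
    (1 + X) * (wMat T).det = X ^ (T.card - 1) * (1 + X) ^ (n + 1 - T.card)
      + (if T.card = n + 1 then X ^ (n + 1) else 0) := by
  rw [Matrix.twoBlockTriangular_det (wMat T) (fun i => i ∈ T)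
    (by intro i hi j hj; simp [wMat, hi, hj])]
  obtain ⟨m, hm⟩ : ∃ m, T.card = m + 1 :=
    ⟨T.card - 1, by have := Finset.card_pos.2 ⟨_, hT⟩; omega⟩
  have hle : T.card ≤ n + 1 := by simpa using Finset.card_le_univ T
  have hA : ((wMat T).toSquareBlockProp (fun i => i ∈ T)).det = X ^ m := by
    have e : Fin (m + 1) ≃o {i // i ∈ T} :=
      Fintype.orderIsoFinOfCardEq _ (by simp [hm])
    have hlast : e (Fin.last m) = ⟨Fin.last n, hT⟩ := by
      apply le_antisymm
      · exact Fin.le_last _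
      · exact e.symm_apply_le.1 (Fin.le_last _)
    rw [← det_A_s16 m, ← Matrix.det_submatrix_equiv_self e.toEquiv]
    congr 1
    ext1 i j
    have h1 : ((e i : Fin (n+1)) = Fin.last n) ↔ i = Fin.last m := by
      rw [← e.injective.eq_iff, hlast, Subtype.ext_iff]
    have h2 : ((e i : Fin (n+1)) < (e j : Fin (n+1))) ↔ i < j := by
      rw [← e.lt_iff_lt, ← Subtype.coe_lt_coe]
    simp [Matrix.toSquareBlockProp_def, wMat, h1, h2]
  have hM : ∀ q, n + 1 - T.card = q + 1 →
      ((wMat T).toSquareBlockProp (fun i => ¬ i ∈ T)).det = (1 + X) ^ q := by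
    intro q hq
    have e : Fin (q + 1) ≃o {i // ¬ i ∈ T} :=
      Fintype.orderIsoFinOfCardEq _ (by
        rw [Fintype.card_subtype_compl]; simp [hq])
    rw [← det_M q, ← Matrix.det_submatrix_equiv_self e.toEquiv]
    congr 1
    ext1 i j
    have h2 : ((e i : Fin (n+1)) < (e j : Fin (n+1))) ↔ i < j := by
      rw [← e.lt_iff_lt, ← Subtype.coe_lt_coe]
    have hi := (e i).2
    have hj := (e j).2
    simp [Matrix.toSquareBlockProp_def, wMat, h2, hi, hj]
  have key : ∀ a b : Polynomial ℤ, a = X ^ m → (1 + X) * (X ^ m * b) =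
      X ^ (T.card - 1) * (1 + X) ^ (n + 1 - T.card)
        + (if T.card = n + 1 then X ^ (n + 1) else 0) → (1 + X) * (a * b) =
      X ^ (T.card - 1) * (1 + X) ^ (n + 1 - T.card)
        + (if T.card = n + 1 then X ^ (n + 1) else 0) := by
    rintro a b rfl h; exact h
  refine key _ _ (by convert hA) ?_
  by_cases hc : T.card = n + 1
  · have : IsEmpty {i // ¬ i ∈ T} := by
      have hu : T = Finset.univ := Finset.eq_univ_of_card T (by simp [hc])
      constructor
      rintro ⟨i, hi⟩
      simp [hu] at hi
    rw [Matrix.det_isEmpty, if_pos hc]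
    have : m = n := by omega
    subst this
    simp [hm]
    ring
  · obtain ⟨q, hq⟩ : ∃ q, n + 1 - T.card = q + 1 := ⟨n - T.card, by omega⟩
    rw [hM q hq, if_neg hc, hq, hm]
    simp
    ring

/-- `π` preserves `T` and is increasing on `T` away from the last element. -/
def GoodFor {n : ℕ} (T : Finset (Fin (n + 1))) (π : Equiv.Perm (Fin (n + 1))) : Prop :=
  ∀ i, (i ∈ T ↔ π i ∈ T) ∧ (i ∈ T → i ≠ Fin.last n → i < π i)

open Classical in
theorem goodFor_iff {n : ℕ} (T : Finset (Fin (n + 1))) (hT : Fin.last n ∈ T)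
    (π : Equiv.Perm (Fin (n + 1))) :
    GoodFor T π ↔ π ∈ Qhat n ∧ T = Finset.univ.filter fun x => π.SameCycle x (Fin.last n) := by
  constructor
  · intro h
    have hz : ∀ x y, π.SameCycle x y → (x ∈ T ↔ y ∈ T) := by
      have hp : ∀ (k : ℕ) x, (x ∈ T ↔ (π ^ k) x ∈ T) := by
        intro k
        induction k with
        | zero => simp
        | succ k ih =>
          intro x
          rw [pow_succ', Equiv.Perm.mul_apply, ← (h _).1, ← ih]
      intro x y hxy
      obtain ⟨k, hk⟩ := hxy.exists_nat_pow_eq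
      rw [← hk]; exact hp k x
    have hup : ∀ d : ℕ, ∀ x : Fin (n + 1), x ∈ T → n - x.val ≤ d →
        π.SameCycle x (Fin.last n) := by
      intro d
      induction d with
      | zero =>
        intro x _ hd
        have : x = Fin.last n := by ext; simp; omega
        rw [this]
      | succ d ih =>
        intro x hx hd
        by_cases hl : x = Fin.last n
        · rw [hl]
        · have h1 := (h x).2 hx hl
          have h2 := ih (π x) ((h x).1.1 hx) (by rw [Fin.lt_def] at h1; omega)
          exact (Equiv.Perm.sameCycle_apply_left).1 h2
    have hTe : ∀ x, x ∈ T ↔ π.SameCycle x (Fin.last n) :=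
      fun x => ⟨fun hx => hup _ x hx le_rfl, fun hx => (hz _ _ hx).2 hT⟩
    refine ⟨?_, by ext x; simp [hTe]⟩
    simp only [Qhat, Finset.mem_filter, Finset.mem_univ, true_and]
    intro x hx hl
    exact (h x).2 ((hTe x).2 hx) hl
  · rintro ⟨hQ, rfl⟩ i
    simp only [Qhat, Finset.mem_filter, Finset.mem_univ, true_and] at hQ ⊢
    exact ⟨Equiv.Perm.sameCycle_apply_left.symm, hQ i⟩

open Polynomial in
open Classical in
theorem prod_wMat {n : ℕ} (T : Finset (Fin (n + 1))) (π : Equiv.Perm (Fin (n + 1))) :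
    ∏ i, wMat T i (π i) = if GoodFor T π then (-X) ^ exc π else 0 := by
  split_ifs with h
  · have : ∀ i, wMat T i (π i) = if i < π i then -X else 1 := by
      intro i
      by_cases hi : i ∈ T
      · have hj := (h i).1.1 hi
        by_cases hl : i = Fin.last n
        · have : ¬ i < π i := by rw [hl]; exact not_lt.2 (Fin.le_last _)
          rw [if_neg this]
          unfold wMat
          rw [if_pos hi, if_pos hj, if_pos hl]
        · simp [wMat, hi, hj, hl, (h i).2 hi hl]
      · have hj : π i ∉ T := fun hj => hi ((h i).1.2 hj)
        simp [wMat, hi, hj]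
    simp only [this]
    rw [Finset.prod_ite]
    simp [exc]
  · unfold GoodFor at h
    push Not at h
    obtain ⟨i, hi⟩ := h
    apply Finset.prod_eq_zero (Finset.mem_univ i)
    by_cases h1 : i ∈ T <;> by_cases h2 : π i ∈ T
    · obtain ⟨_, h3, h4⟩ := hi (by tauto)
      simp [wMat, h1, h2, h3, not_lt.2 h4]
    · simp [wMat, h1, h2]
    · simp [wMat, h1, h2]
    · have := hi (by tauto)
      tauto

/-- The generating polynomial. -/
noncomputable def genP (n : ℕ) : Polynomial ℤ :=
  ∑ π ∈ Qhat n, Polynomial.C ((-1 : ℤ) ^ (cyc π + aexc π)) * Polynomial.X ^ exc π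

/-- Extension of a subset of `Fin n` by the last element. -/
def extT {n : ℕ} (S : Finset (Fin n)) : Finset (Fin (n + 1)) :=
  insert (Fin.last n) (S.map Fin.castSuccEmb)

theorem extT_card {n : ℕ} (S : Finset (Fin n)) : (extT S).card = S.card + 1 := by
  unfold extT
  rw [Finset.card_insert_of_notMem, Finset.card_map]
  simp [(Fin.castSucc_lt_last _).ne]

theorem extT_eq_iff {n : ℕ} (S : Finset (Fin n)) (T : Finset (Fin (n + 1)))
    (hT : Fin.last n ∈ T) :
    extT S = T ↔ S = Finset.univ.filter fun x => x.castSucc ∈ T := by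
  constructor
  · rintro rfl
    ext x
    simp [extT, (Fin.castSucc_lt_last _).ne]
  · rintro rfl
    ext x
    refine Fin.lastCases ?_ (fun x => ?_) x
    · simp [extT, hT]
    · simp [extT, (Fin.castSucc_lt_last _).ne]

open Polynomial in
open Classical in
theorem genP_eq (n : ℕ) : genP n = ∑ S : Finset (Fin n), (wMat (extT S)).det := by
  have hd : ∀ S : Finset (Fin n), (wMat (extT S)).det
      = ∑ π : Equiv.Perm (Fin (n + 1)), if π ∈ Qhat n ∧ extT S =
          (Finset.univ.filter fun x => π.SameCycle x (Fin.last n)) then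
          C ((-1 : ℤ) ^ (cyc π + aexc π)) * X ^ exc π else 0 := by
    intro S
    rw [← Matrix.det_transpose, Matrix.det_apply']
    refine Finset.sum_congr rfl fun π _ => ?_
    simp only [Matrix.transpose_apply]
    rw [prod_wMat, sign_weight]
    simp only [goodFor_iff (extT S) (by simp [extT]) π]
    split_ifs
    · rw [neg_pow (X : Polynomial ℤ)]
      simp
      ring
    · simp
  simp only [hd]
  rw [Finset.sum_comm]
  unfold genP
  rw [← Finset.sum_subset (Finset.subset_univ (Qhat n))]
  · refine Finset.sum_congr rfl fun π hπ => ?_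
    simp only [hπ, true_and]
    have key : ∀ (T : Finset (Fin (n + 1))) (w : Polynomial ℤ), Fin.last n ∈ T →
        w = ∑ S : Finset (Fin n), if extT S = T then w else 0 := by
      intro T w hT
      simp only [fun S => extT_eq_iff S T hT]
      simp
    exact key _ _ (by simp [Equiv.Perm.SameCycle.refl])
  · intro π _ hπ
    simp [hπ]

open Polynomial in
theorem genP_mul (n : ℕ) : (1 + X) * genP n = (1 + C 2 * X) ^ n + X ^ (n + 1) := by
  rw [genP_eq, Finset.mul_sum]
  simp only [fun S : Finset (Fin n) => det_wMat (extT S) (by simp [extT]), extT_card]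
  rw [Finset.sum_add_distrib]
  congr 1
  · have := Fintype.sum_pow_mul_eq_add_pow (Fin n) (X : Polynomial ℤ) (1 + X)
    simp only [Fintype.card_fin] at this
    simp only [Nat.add_sub_add_right, Nat.add_sub_cancel]
    rw [this]
    congr 1
    simp only [map_ofNat]
    ring
  · rw [Finset.sum_eq_single Finset.univ]
    · simp
    · intro S _ hS
      rw [if_neg]
      intro h
      exact hS (Finset.eq_univ_of_card S (by simp; omega))
    · simp

theorem BettiB_rec (n k : ℕ) (hk : k ≤ n) :
    BettiB n k + BettiB n (k + 1) = 2 ^ (n - k) * n.choose k := by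
  unfold BettiB
  rw [← Finset.add_sum_Ioc_eq_sum_Icc hk]
  have : Finset.Icc (k + 1) n = Finset.Ioc k n := by ext; simp [Nat.succ_le_iff]
  rw [this, add_assoc, ← Finset.sum_add_distrib, Finset.sum_eq_zero]
  · simp
  · intro i hi
    rw [Finset.mem_Ioc] at hi
    obtain ⟨j, rfl⟩ : ∃ j, i = k + 1 + j := ⟨i - (k + 1), by omega⟩
    have h1 : k + 1 + j - k = j + 1 := by omega
    have h2 : k + 1 + j - (k + 1) = j := by omega
    rw [h1, h2]
    ring

open Polynomial in
theorem coeff_pow (n m : ℕ) : ((1 + C 2 * X : Polynomial ℤ) ^ n).coeff m = 2 ^ m * n.choose m := by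
  have : (1 + C 2 * X : Polynomial ℤ) ^ n = ((1 + X) ^ n).comp (C 2 * X) := by simp
  rw [this, Polynomial.comp_C_mul_X_coeff, Polynomial.coeff_one_add_X_pow]
  ring

open Polynomial in
theorem genP_coeff (n m : ℕ) (hm : m ≤ n) : (genP n).coeff m = BettiB n (n - m) := by
  induction m with
  | zero =>
    have h := congrArg (fun p => p.coeff 0) (genP_mul n)
    simp only [add_mul, one_mul, coeff_add, coeff_pow] at h
    simp [coeff_X_pow] at h
    simp [BettiB, h]
  | succ m ih =>
    have h := congrArg (fun p => p.coeff (m + 1)) (genP_mul n)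
    simp only [add_mul, one_mul, coeff_add, coeff_pow, coeff_X_mul, coeff_X_pow] at h
    rw [if_neg (by omega), ih (by omega)] at h
    have hr := BettiB_rec n (n - (m + 1)) (by omega)
    rw [show n - (m + 1) + 1 = n - m by omega, Nat.choose_symm hm,
      show n - (n - (m + 1)) = m + 1 by omega] at hr
    linarith

theorem BettiB_combinatorial (n k : ℕ) (hk : k ≤ n) :
    BettiB n k
      = ∑ π ∈ (Qhat n).filter fun π => exc π = n - k,
          (-1 : ℤ) ^ (cyc π + aexc π) := by
  have h := genP_coeff n (n - k) (by omega)
  rw [show n - (n - k) = k by omega] at h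
  rw [← h, genP, Polynomial.finsetSum_coeff, Finset.sum_filter]
  refine Finset.sum_congr rfl fun π _ => ?_
  rw [Polynomial.coeff_C_mul, Polynomial.coeff_X_pow]
  by_cases he : exc π = n - k
  · simp [he]
  · simp [he, Ne.symm he]
end
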